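/- arXiv:2105.05025 — 3 statements merged into one kernel-verified Lean document; each statement's English description precedes it below -/
import Mathlib

section
/- For every s > 0 and every ε > 0 there exists a constant C = C(s,ε) > 0 such that for all trigonometric polynomials u, v : S¹ → ℝ, writing g(x) := ∫_{S¹}(u(x)−u(y))(v(x)−v(y))/|x−y|² dy (i.e. g = d_{1/2}u·d_{1/2}v), one has: Σ_{n∈ℤ} |n|^{2s} |ĝ(n)|² ≤ C [ (Σ_{j∈ℤ}|j|^{1+2s+4ε}|û(j)|²)(Σ_{j∈ℤ} j²|v̂(j)|²) + (Σ_{j∈ℤ} j²|û(j)|²)(Σ_{j∈ℤ}|j|^{1+2s+4ε}|v̂(j)|²) ]. (This is the estimate ‖d_{1/2}u·d_{1/2}v‖_{Ḣ^s} ≲ ‖(−Δ)^{1/4+s/2+ε}u‖_{L²}‖(−Δ)^{1/2}v‖_{L²} + ‖(−Δ)^{1/2}u‖_{L²}‖(−Δ)^{1/4+s/2+ε}v‖_{L²}.) -/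
open MeasureTheory Real Filter
open scoped BigOperators ENNReal Real Topology

noncomputable section

/-- Chord distance on `S¹ ≃ ℝ/2πℤ`: `|x-y| = 2|sin((x-y)/2)|`. -/
def cd (x y : ℝ) : ℝ := 2 * |Real.sin ((x - y) / 2)|

/-- Fundamental domain for the circle `S¹ ≃ ℝ/2πℤ`. -/
def circ : Set ℝ := Set.Ioc (-π) π

/-- `k`-th Fourier coefficient of a `2π`-periodic function `ℝ → ℂ`. -/
def fc (f : ℝ → ℂ) (k : ℤ) : ℂ :=
  ((1 / (2 * π) : ℝ) : ℂ) * ∫ x in circ, f x * Complex.exp (-(Complex.I * (k : ℂ) * (x : ℂ)))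

/-- Fourier coefficient of a real-valued function. -/
def fcR (f : ℝ → ℝ) (k : ℤ) : ℂ := fc (fun x => (f x : ℂ)) k

/-- `ℝⁿ` as a Euclidean space. -/
abbrev E (n : ℕ) := EuclideanSpace ℝ (Fin n)

/-- Componentwise Fourier coefficients of a vector-valued map. -/
def fcV {n : ℕ} (u : ℝ → E n) (k : ℤ) (i : Fin n) : ℂ := fcR (fun x => u x i) k

/-- Squared homogeneous `Ḣ^{1/2}` seminorm: `∑_k |k| |û(k)|²` (valued in `[0,∞]`). -/
def hHalf {n : ℕ} (u : ℝ → E n) : ℝ≥0∞ :=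
  ∑' k : ℤ, (k.natAbs : ℝ≥0∞) * ∑ i, (‖fcV u k i‖₊ : ℝ≥0∞) ^ 2

/-- Squared inhomogeneous `H^s` norm: `∑_k (1+k²)^s |û(k)|²` (valued in `[0,∞]`). -/
def hSob {n : ℕ} (s : ℝ) (u : ℝ → E n) : ℝ≥0∞ :=
  ∑' k : ℤ, ENNReal.ofReal ((1 + (k : ℝ) ^ 2) ^ s) * ∑ i, (‖fcV u k i‖₊ : ℝ≥0∞) ^ 2

/-- Squared homogeneous `Ḣ^{1/2}` seminorm of a scalar function. -/
def hHalfR (f : ℝ → ℝ) : ℝ≥0∞ :=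
  ∑' k : ℤ, (k.natAbs : ℝ≥0∞) * (‖fcR f k‖₊ : ℝ≥0∞) ^ 2

/-- Squared inhomogeneous `H^s` norm of a scalar function. -/
def hSobR (s : ℝ) (f : ℝ → ℝ) : ℝ≥0∞ :=
  ∑' k : ℤ, ENNReal.ofReal ((1 + (k : ℝ) ^ 2) ^ s) * (‖fcR f k‖₊ : ℝ≥0∞) ^ 2

/-- `|d_{1/2}u|²(x) = ∫_{S¹} |u(x)-u(y)|²/|x-y|² dy`. -/
def gagl {n : ℕ} (u : ℝ → E n) (x : ℝ) : ℝ :=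
  ∫ y in circ, (∑ i, (u x i - u y i) ^ 2) / cd x y ^ 2

/-- `∫_{S¹}∫_{S¹} d_{1/2}u(x,y)·d_{1/2}φ(x,y) dy dx/|x-y|`. -/
def pairing {n : ℕ} (u φ : ℝ → E n) : ℝ :=
  ∫ x in circ, ∫ y in circ, (∑ i, (u x i - u y i) * (φ x i - φ y i)) / cd x y ^ 2

/-- The product measure on `(0,∞) × S¹`. -/
def STmeasure : Measure (ℝ × ℝ) :=
  (volume.restrict (Set.Ioi (0 : ℝ))).prod (volume.restrict circ)

/-- Smooth test functions on `(0,∞) × S¹`, compactly supported in time. -/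
structure IsSTTest (n : ℕ) (φ : ℝ → ℝ → E n) : Prop where
  smooth : ContDiff ℝ (⊤ : ℕ∞) (fun p : ℝ × ℝ => φ p.1 p.2)
  periodic : ∀ t, Function.Periodic (φ t) (2 * π)
  suppTime : ∃ a b : ℝ, 0 < a ∧ ∀ t, t ∉ Set.Icc a b → ∀ x, φ t x = 0

/-- Energy-class solution of the half-harmonic gradient flow, with explicit
weak time derivative `w`. -/
structure IsEnergySolAux (n : ℕ) (u₀ : ℝ → E n) (u w : ℝ → ℝ → E n) : Prop where
  meas : Measurable (Function.uncurry u)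
  periodic : ∀ t, Function.Periodic (u t) (2 * π)
  sphere : ∀ᵐ p ∂STmeasure, ‖u p.1 p.2‖ = 1
  energyBdd : ∃ M : ℝ≥0∞, M < ⊤ ∧
    ∀ᵐ t ∂(volume.restrict (Set.Ioi (0 : ℝ))), hHalf (u t) ≤ M
  wMeas : Measurable (Function.uncurry w)
  wL2 : (∫⁻ t in Set.Ioi (0 : ℝ), ∫⁻ x in circ, (‖w t x‖₊ : ℝ≥0∞) ^ 2) < ⊤
  weakDeriv : ∀ φ : ℝ → ℝ → E n, IsSTTest n φ →
    (∫ t in Set.Ioi (0 : ℝ), ∫ x in circ, ∑ i, u t x i * deriv (fun s => φ s x i) t)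
      = - ∫ t in Set.Ioi (0 : ℝ), ∫ x in circ, ∑ i, w t x i * φ t x i
  flow : ∀ φ : ℝ → ℝ → E n, IsSTTest n φ →
    (∫ t in Set.Ioi (0 : ℝ), ∫ x in circ, ∑ i, w t x i * φ t x i)
      + (∫ t in Set.Ioi (0 : ℝ), pairing (u t) (φ t))
      = ∫ t in Set.Ioi (0 : ℝ), ∫ x in circ, gagl (u t) x * ∑ i, u t x i * φ t x i
  init : Tendsto (fun t => ∫⁻ x in circ, (‖u t x - u₀ x‖₊ : ℝ≥0∞) ^ 2)
      (nhdsWithin 0 (Set.Ioi 0)) (nhds 0)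

/-- Energy-class solution of the half-harmonic gradient flow. -/
def IsEnergySol (n : ℕ) (u₀ : ℝ → E n) (u : ℝ → ℝ → E n) : Prop :=
  ∃ w, IsEnergySolAux n u₀ u w

/-- Energy decay: `‖u(t,·)‖_{Ḣ^{1/2}} ≤ ‖u₀‖_{Ḣ^{1/2}}` for a.e. `t ≥ 0`. -/
def EnergyDecay {n : ℕ} (u₀ : ℝ → E n) (u : ℝ → ℝ → E n) : Prop :=
  ∀ᵐ t ∂(volume.restrict (Set.Ioi (0 : ℝ))), hHalf (u t) ≤ hHalf u₀

/-- Fractional Laplacian `(-Δ)^s` of a `2π`-periodic function, via Fourier series. -/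
def fracLapC (s : ℝ) (f : ℝ → ℂ) (x : ℝ) : ℂ :=
  ∑' k : ℤ, (((k.natAbs : ℝ) ^ s : ℝ) : ℂ) * fc f k * Complex.exp (Complex.I * (k : ℂ) * (x : ℂ))

/-- Fractional Laplacian of a real-valued function. -/
def fracLapR (s : ℝ) (f : ℝ → ℝ) (x : ℝ) : ℝ := (fracLapC s (fun y => (f y : ℂ)) x).re

/-- Half-Laplacian of a vector-valued map. -/
def halfLap {n : ℕ} (u : ℝ → E n) (x : ℝ) : E n :=
  (EuclideanSpace.equiv (Fin n) ℝ).symm fun i => fracLapR 1 (fun y => u y i) x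

/-- The integral `C(j,k) = ∫_{-π}^{π} (e^{ijh}-1)(e^{ikh}-1)/(4sin²(h/2)) dh`. -/
def Cjk (j k : ℤ) : ℂ :=
  ∫ h in circ, (Complex.exp (Complex.I * (j : ℂ) * (h : ℂ)) - 1)
      * (Complex.exp (Complex.I * (k : ℂ) * (h : ℂ)) - 1)
      / ((4 * Real.sin (h / 2) ^ 2 : ℝ) : ℂ)

/-- A real trigonometric polynomial: the function equals a finite Fourier sum. -/
def IsTrigPoly (u : ℝ → ℝ) : Prop :=
  ∃ s : Finset ℤ, ∀ x : ℝ,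
    (u x : ℂ) = ∑ k ∈ s, fcR u k * Complex.exp (Complex.I * (k : ℂ) * (x : ℂ))

/-- `d_{1/2}u · d_{1/2}v` as a (complex-valued) function on the circle. -/
def d12prod (u v : ℝ → ℝ) (x : ℝ) : ℂ :=
  ((∫ y in circ, (u x - u y) * (v x - v y) / cd x y ^ 2 : ℝ) : ℂ)

/-- Stereographic projection of `S¹ ∖ {-i}`. -/
def stproj (θ : ℝ) : ℝ := Real.cos θ / (1 + Real.sin θ)


lemma integral_circ_exp (m : ℤ) :
    ∫ x in circ, Complex.exp (Complex.I * (m : ℂ) * (x : ℂ)) = if m = 0 then (2 * π : ℂ) else 0 := by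
  have hpi : -π ≤ π := by linarith [Real.pi_pos]
  rw [circ, ← intervalIntegral.integral_of_le hpi]
  split_ifs with h
  · subst h
    simp
    ring
  · have hm : Complex.I * (m : ℂ) ≠ 0 := mul_ne_zero Complex.I_ne_zero (by exact_mod_cast h)
    rw [integral_exp_mul_complex hm, div_eq_zero_iff, sub_eq_zero]
    left
    rw [Complex.exp_eq_exp_iff_exists_int]
    exact ⟨m, by push_cast; ring⟩

lemma exp_mul_I_add (j k : ℤ) (x : ℝ) :
    Complex.exp (Complex.I * ((j + k : ℤ) : ℂ) * (x : ℂ)) =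
      Complex.exp (Complex.I * (j : ℂ) * (x : ℂ)) * Complex.exp (Complex.I * (k : ℂ) * (x : ℂ)) := by
  rw [← Complex.exp_add]
  push_cast
  ring_nf

lemma continuous_exp_mul_I (m : ℤ) :
    Continuous fun x : ℝ => Complex.exp (Complex.I * (m : ℂ) * (x : ℂ)) := by
  fun_prop

lemma integrableOn_circ {f : ℝ → ℂ} (hf : Continuous f) : IntegrableOn f circ :=
  (hf.integrableOn_Icc (a := -π) (b := π)).mono_set Set.Ioc_subset_Icc_self

lemma fc_sum_exp {ι : Type*} (S : Finset ι) (c : ι → ℂ) (m : ι → ℤ) (n : ℤ) :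
    fc (fun x => ∑ i ∈ S, c i * Complex.exp (Complex.I * (m i : ℂ) * (x : ℂ))) n =
      ∑ i ∈ S, if m i = n then c i else 0 := by
  have h1 : ∀ x : ℝ, (∑ i ∈ S, c i * Complex.exp (Complex.I * (m i : ℂ) * (x : ℂ))) *
      Complex.exp (-(Complex.I * (n : ℂ) * (x : ℂ))) =
      ∑ i ∈ S, c i * Complex.exp (Complex.I * ((m i - n : ℤ) : ℂ) * (x : ℂ)) := by
    intro x
    rw [Finset.sum_mul]
    refine Finset.sum_congr rfl fun i _ => ?_
    rw [mul_assoc, ← Complex.exp_add]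
    push_cast
    ring_nf
  simp only [fc, h1]
  rw [integral_finsetSum _ fun i _ =>
    ((integrableOn_circ (continuous_exp_mul_I (m i - n))).integrable.const_mul (c i))]
  simp only [integral_const_mul, integral_circ_exp, sub_eq_zero]
  rw [Finset.mul_sum]
  refine Finset.sum_congr rfl fun i _ => ?_
  have hpi : (π : ℂ) ≠ 0 := by exact_mod_cast Real.pi_ne_zero
  split_ifs
  · push_cast
    field_simp
  · simp

lemma exp_sub_one_factor (j : ℤ) : ∃ (c : ℂ) (p : ℤ), ‖c‖ = 1 ∧ ∀ h : ℝ,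
    Complex.exp (Complex.I * (j : ℂ) * (h : ℂ)) - 1 =
      c * Complex.exp (Complex.I * (p : ℂ) * (h : ℂ)) * (Complex.exp (Complex.I * (h : ℂ)) - 1) *
        ∑ a ∈ Finset.range j.natAbs, Complex.exp (Complex.I * ((a : ℤ) : ℂ) * (h : ℂ)) := by
  have hpow : ∀ (n : ℕ) (h : ℝ), Complex.exp (Complex.I * ((n : ℤ) : ℂ) * (h : ℂ)) =
      Complex.exp (Complex.I * (h : ℂ)) ^ n := by
    intro n h
    rw [← Complex.exp_nat_mul]
    push_cast
    ring_nf
  obtain ⟨n, rfl | rfl⟩ := j.eq_nat_or_neg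
  · refine ⟨1, 0, by simp, fun h => ?_⟩
    simp only [hpow, Int.natAbs_natCast]
    rw [mul_assoc, mul_geom_sum]
    simp
  · refine ⟨-1, -(n : ℤ), by simp, fun h => ?_⟩
    have h0 : Complex.exp (Complex.I * ((-(n : ℤ) : ℤ) : ℂ) * (h : ℂ)) *
        Complex.exp (Complex.I * (h : ℂ)) ^ n = 1 := by
      rw [← hpow, ← exp_mul_I_add]
      simp
    simp only [hpow, Int.natAbs_natCast, Int.natAbs_neg]
    rw [mul_assoc (-1 * _), mul_geom_sum]
    linear_combination h0

lemma exp_sub_one_sq (h : ℝ) : (Complex.exp (Complex.I * (h : ℂ)) - 1) ^ 2 =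
    -Complex.exp (Complex.I * (h : ℂ)) * ((4 * Real.sin (h / 2) ^ 2 : ℝ) : ℂ) := by
  have h1 : Real.sin (h / 2) ^ 2 = (1 - Real.cos h) / 2 := by
    rw [Real.sin_sq, Real.cos_sq, mul_div_cancel₀ _ (two_ne_zero)]
    ring
  rw [h1, mul_comm Complex.I, Complex.exp_mul_I, ← Complex.ofReal_cos, ← Complex.ofReal_sin]
  have h2 : ((Real.sin h : ℝ) : ℂ) ^ 2 = 1 - ((Real.cos h : ℝ) : ℂ) ^ 2 := by
    rw [← Complex.ofReal_pow, Real.sin_sq]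
    push_cast
    ring
  push_cast
  push_cast at h2
  linear_combination (Complex.I ^ 2) * h2 + (1 - Complex.cos h ^ 2) * Complex.I_sq

/-- The integrand of `Cjk`. -/
def kernelCjk (j k : ℤ) (h : ℝ) : ℂ :=
  (Complex.exp (Complex.I * (j : ℂ) * (h : ℂ)) - 1)
      * (Complex.exp (Complex.I * (k : ℂ) * (h : ℂ)) - 1)
      / ((4 * Real.sin (h / 2) ^ 2 : ℝ) : ℂ)

lemma kernelCjk_eq_sum (j k : ℤ) : ∃ (c : ℂ) (p : ℤ), ‖c‖ = 1 ∧ ∀ h : ℝ, Real.sin (h / 2) ≠ 0 →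
    kernelCjk j k h = c * ∑ a ∈ Finset.range j.natAbs, ∑ b ∈ Finset.range k.natAbs,
      Complex.exp (Complex.I * ((p + a + b : ℤ) : ℂ) * (h : ℂ)) := by
  obtain ⟨c, p, hc, hj⟩ := exp_sub_one_factor j
  obtain ⟨d, q, hd, hk⟩ := exp_sub_one_factor k
  refine ⟨-(c * d), p + q + 1, by simp [hc, hd], fun h hs => ?_⟩
  have hs' : ((4 * Real.sin (h / 2) ^ 2 : ℝ) : ℂ) ≠ 0 := by
    exact_mod_cast (by positivity : (4 * Real.sin (h / 2) ^ 2 : ℝ) ≠ 0)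
  have h1 : Complex.exp (Complex.I * ((1 : ℤ) : ℂ) * (h : ℂ)) = Complex.exp (Complex.I * (h : ℂ)) := by
    simp
  rw [kernelCjk, hj, hk, div_eq_iff hs']
  simp only [exp_mul_I_add, ← Finset.mul_sum, ← Finset.sum_mul, h1]
  linear_combination (c * d * Complex.exp (Complex.I * (p : ℂ) * (h : ℂ))
    * Complex.exp (Complex.I * (q : ℂ) * (h : ℂ))
    * (∑ a ∈ Finset.range j.natAbs, Complex.exp (Complex.I * ((a : ℤ) : ℂ) * (h : ℂ)))
    * (∑ a ∈ Finset.range k.natAbs, Complex.exp (Complex.I * ((a : ℤ) : ℂ) * (h : ℂ))))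
    * exp_sub_one_sq h

lemma ae_sin_half_ne_zero : ∀ᵐ h ∂(volume.restrict circ), Real.sin (h / 2) ≠ 0 := by
  have h0 : ∀ᵐ h ∂(volume.restrict circ), h ≠ (0 : ℝ) :=
    ae_restrict_of_ae (Measure.ae_ne volume 0)
  filter_upwards [h0, ae_restrict_mem measurableSet_Ioc] with h hne hmem hsin
  have hpi := Real.pi_pos
  rw [Real.sin_eq_zero_iff_of_lt_of_lt (by linarith [hmem.1]) (by linarith [hmem.2])] at hsin
  exact hne (by linarith)

lemma integrableOn_kernelCjk (j k : ℤ) : IntegrableOn (kernelCjk j k) circ := by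
  obtain ⟨c, p, -, h⟩ := kernelCjk_eq_sum j k
  refine (integrableOn_circ (f := fun h : ℝ => c * ∑ a ∈ Finset.range j.natAbs,
    ∑ b ∈ Finset.range k.natAbs, Complex.exp (Complex.I * ((p + a + b : ℤ) : ℂ) * (h : ℂ)))
    (by fun_prop)).congr ?_
  filter_upwards [ae_sin_half_ne_zero] with x hx using (h x hx).symm

lemma norm_Cjk_le_left (j k : ℤ) : ‖Cjk j k‖ ≤ 2 * π * |(j : ℝ)| := by
  obtain ⟨c, p, hc, h⟩ := kernelCjk_eq_sum j k
  have h1 : Cjk j k = ∫ x in circ, c * ∑ a ∈ Finset.range j.natAbs,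
      ∑ b ∈ Finset.range k.natAbs, Complex.exp (Complex.I * ((p + a + b : ℤ) : ℂ) * (x : ℂ)) := by
    refine integral_congr_ae ?_
    filter_upwards [ae_sin_half_ne_zero] with x hx using h x hx
  rw [h1, integral_const_mul, integral_finsetSum _ fun a _ => integrable_finsetSum _ fun b _ =>
    integrableOn_circ (continuous_exp_mul_I _)]
  rw [norm_mul, hc, one_mul]
  have h2 : ∀ a ∈ Finset.range j.natAbs, ‖∫ x in circ, ∑ b ∈ Finset.range k.natAbs,
      Complex.exp (Complex.I * ((p + a + b : ℤ) : ℂ) * (x : ℂ))‖ ≤ 2 * π := by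
    intro a _
    have hpi := Real.pi_pos
    rw [integral_finsetSum _ fun b _ => integrableOn_circ (continuous_exp_mul_I _)]
    simp only [integral_circ_exp]
    by_cases hb : ∃ b : ℕ, p + a + b = 0
    · obtain ⟨b₀, hb₀⟩ := hb
      have : ∀ b : ℕ, p + a + b = 0 ↔ b₀ = b := fun b => by omega
      simp only [this, Finset.sum_ite_eq]
      split_ifs
      · simp [abs_of_pos hpi]
      · simp [hpi.le]
    · push Not at hb
      simp [hb, hpi.le]
  refine (norm_sum_le_of_le _ h2).trans (le_of_eq ?_)
  simp [Nat.cast_natAbs]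
  ring

lemma Cjk_comm (j k : ℤ) : Cjk j k = Cjk k j := by
  simp only [Cjk, mul_comm]

lemma norm_Cjk_le_right (j k : ℤ) : ‖Cjk j k‖ ≤ 2 * π * |(k : ℝ)| :=
  Cjk_comm j k ▸ norm_Cjk_le_left k j

lemma periodic_kernelCjk (j k : ℤ) : Function.Periodic (kernelCjk j k) (2 * π) := by
  have h1 : ∀ (m : ℤ) (h : ℝ), Complex.exp (Complex.I * (m : ℂ) * ((h + 2 * π : ℝ) : ℂ)) =
      Complex.exp (Complex.I * (m : ℂ) * (h : ℂ)) := by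
    intro m h
    rw [Complex.exp_eq_exp_iff_exists_int]
    exact ⟨m, by push_cast; ring⟩
  intro h
  have h2 : (h + 2 * π) / 2 = h / 2 + π := by ring
  simp only [kernelCjk, h1, h2, Real.sin_add_pi, neg_sq]

lemma intervalIntegrable_kernelCjk (j k : ℤ) (a b : ℝ) :
    IntervalIntegrable (kernelCjk j k) volume a b := by
  have hpi := Real.pi_pos
  refine (periodic_kernelCjk j k).intervalIntegrable (t := -π) (by positivity) ?_ a b
  rw [show -π + 2 * π = π by ring, intervalIntegrable_iff_integrableOn_Ioc_of_le (by linarith)]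
  exact integrableOn_kernelCjk j k

lemma integrable_kernelCjk_sub (j k : ℤ) (x : ℝ) :
    IntegrableOn (fun y => kernelCjk j k (y - x)) circ := by
  have hpi : -π ≤ π := by linarith [Real.pi_pos]
  rw [circ, ← intervalIntegrable_iff_integrableOn_Ioc_of_le hpi]
  simpa using (intervalIntegrable_kernelCjk j k (-π - x) (π - x)).comp_sub_right x

lemma integral_kernelCjk_sub (j k : ℤ) (x : ℝ) :
    ∫ y in circ, kernelCjk j k (y - x) = Cjk j k := by
  have hpi : -π ≤ π := by linarith [Real.pi_pos]
  have h1 : Cjk j k = ∫ y in circ, kernelCjk j k y := rfl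
  rw [h1, circ, ← intervalIntegral.integral_of_le hpi, ← intervalIntegral.integral_of_le hpi,
    intervalIntegral.integral_comp_sub_right (kernelCjk j k)]
  have := (periodic_kernelCjk j k).intervalIntegral_add_eq (-π - x) (-π)
  rw [show -π - x + 2 * π = π - x by ring, show -π + 2 * π = π by ring] at this
  exact this

lemma exp_sub_exp_mul_div (j k : ℤ) (x y : ℝ) :
    (Complex.exp (Complex.I * (j : ℂ) * (x : ℂ)) - Complex.exp (Complex.I * (j : ℂ) * (y : ℂ))) *
      (Complex.exp (Complex.I * (k : ℂ) * (x : ℂ)) - Complex.exp (Complex.I * (k : ℂ) * (y : ℂ))) /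
      ((cd x y : ℝ) : ℂ) ^ 2 =
    Complex.exp (Complex.I * ((j + k : ℤ) : ℂ) * (x : ℂ)) * kernelCjk j k (y - x) := by
  have hcd : ((cd x y : ℝ) : ℂ) ^ 2 = ((4 * Real.sin ((y - x) / 2) ^ 2 : ℝ) : ℂ) := by
    rw [← Complex.ofReal_pow, cd, mul_pow, sq_abs, ← neg_sub y x, neg_div, Real.sin_neg, neg_sq]
    norm_num
  have hexp : ∀ m : ℤ, Complex.exp (Complex.I * (m : ℂ) * (y : ℂ)) =
      Complex.exp (Complex.I * (m : ℂ) * (x : ℂ)) *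
        Complex.exp (Complex.I * (m : ℂ) * ((y - x : ℝ) : ℂ)) := by
    intro m
    rw [← Complex.exp_add]
    push_cast
    ring_nf
  rw [hcd, kernelCjk, exp_mul_I_add, hexp j, hexp k, mul_div_assoc']
  ring

lemma d12prod_eq_sum {u v : ℝ → ℝ} {S T : Finset ℤ}
    (hu : ∀ x : ℝ, (u x : ℂ) = ∑ k ∈ S, fcR u k * Complex.exp (Complex.I * (k : ℂ) * (x : ℂ)))
    (hv : ∀ x : ℝ, (v x : ℂ) = ∑ k ∈ T, fcR v k * Complex.exp (Complex.I * (k : ℂ) * (x : ℂ)))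
    (x : ℝ) :
    d12prod u v x = ∑ q ∈ S ×ˢ T, fcR u q.1 * fcR v q.2 * Cjk q.1 q.2 *
      Complex.exp (Complex.I * ((q.1 + q.2 : ℤ) : ℂ) * (x : ℂ)) := by
  have h1 : ∀ y : ℝ, (((u x - u y) * (v x - v y) / cd x y ^ 2 : ℝ) : ℂ) =
      ∑ q ∈ S ×ˢ T, fcR u q.1 * fcR v q.2 *
        Complex.exp (Complex.I * ((q.1 + q.2 : ℤ) : ℂ) * (x : ℂ)) *
        kernelCjk q.1 q.2 (y - x) := by
    intro y
    rw [Complex.ofReal_div, Complex.ofReal_mul, Complex.ofReal_sub, Complex.ofReal_sub,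
      Complex.ofReal_pow, hu x, hu y, hv x, hv y, ← Finset.sum_sub_distrib, ← Finset.sum_sub_distrib,
      Finset.sum_mul_sum, ← Finset.sum_product', Finset.sum_div]
    refine Finset.sum_congr rfl fun q _ => ?_
    linear_combination fcR u q.1 * fcR v q.2 * exp_sub_exp_mul_div q.1 q.2 x y
  rw [d12prod, ← integral_complex_ofReal]
  simp only [h1]
  rw [integral_finsetSum _ fun q _ => (integrable_kernelCjk_sub q.1 q.2 x).integrable.const_mul _]
  refine Finset.sum_congr rfl fun q _ => ?_
  rw [integral_const_mul, integral_kernelCjk_sub]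
  ring

lemma fcR_eq_zero {u : ℝ → ℝ} {S : Finset ℤ}
    (hu : ∀ x : ℝ, (u x : ℂ) = ∑ k ∈ S, fcR u k * Complex.exp (Complex.I * (k : ℂ) * (x : ℂ)))
    {n : ℤ} (hn : n ∉ S) : fcR u n = 0 := by
  rw [fcR, funext hu, fc_sum_exp]
  simp [hn]

lemma norm_fc_d12prod_le {u v : ℝ → ℝ} {S T : Finset ℤ}
    (hu : ∀ x : ℝ, (u x : ℂ) = ∑ k ∈ S, fcR u k * Complex.exp (Complex.I * (k : ℂ) * (x : ℂ)))
    (hv : ∀ x : ℝ, (v x : ℂ) = ∑ k ∈ T, fcR v k * Complex.exp (Complex.I * (k : ℂ) * (x : ℂ)))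
    (n : ℤ) :
    ‖fc (d12prod u v) n‖ ≤ ∑ q ∈ S ×ˢ T with q.1 + q.2 = n,
      2 * π * min |(q.1 : ℝ)| |(q.2 : ℝ)| * (‖fcR u q.1‖ * ‖fcR v q.2‖) := by
  rw [funext (d12prod_eq_sum hu hv),
    fc_sum_exp (S ×ˢ T) (fun q => fcR u q.1 * fcR v q.2 * Cjk q.1 q.2) (fun q => q.1 + q.2),
    ← Finset.sum_filter]
  refine norm_sum_le_of_le _ fun q _ => ?_
  rw [norm_mul, norm_mul, mul_comm]
  refine mul_le_mul_of_nonneg_right ?_ (by positivity)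
  rw [mul_min_of_nonneg _ _ (by positivity)]
  exact le_min (norm_Cjk_le_left _ _) (norm_Cjk_le_right _ _)

lemma rpow_mul_min_le {s δ x y t : ℝ} (hs : 0 ≤ s) (hδ : 0 ≤ δ) (hx : 0 ≤ x) (hy : 0 ≤ y)
    (ht : 0 ≤ t) (hxy : t ≤ x + y) :
    t ^ s * min x y ≤ 2 ^ s * (x ^ (δ + s) * y * y ^ (-δ) + x * y ^ (δ + s) * x ^ (-δ)) := by
  wlog h : y ≤ x generalizing x y
  · have := this hy hx (by linarith) (le_of_not_ge h)
    rw [min_comm]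
    linarith
  rw [min_eq_right h]
  rcases hy.eq_or_lt with rfl | hy'
  · rw [mul_zero]
    positivity
  have hx' : 0 < x := hy'.trans_le h
  have h1 : t ^ s ≤ 2 ^ s * x ^ s := by
    rw [← Real.mul_rpow zero_le_two hx]
    exact Real.rpow_le_rpow ht (by linarith) hs
  have h2 : 1 ≤ x ^ δ * y ^ (-δ) := by
    rw [Real.rpow_neg hy, ← div_eq_mul_inv, one_le_div (Real.rpow_pos_of_pos hy' _)]
    exact Real.rpow_le_rpow hy h hδ
  calc t ^ s * y ≤ 2 ^ s * x ^ s * y * 1 := by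
        rw [mul_one]
        exact mul_le_mul_of_nonneg_right h1 hy
    _ ≤ 2 ^ s * x ^ s * y * (x ^ δ * y ^ (-δ)) := by gcongr
    _ = 2 ^ s * (x ^ (δ + s) * y * y ^ (-δ)) := by
        rw [Real.rpow_add hx']
        ring
    _ ≤ _ := by
        gcongr
        exact le_add_of_nonneg_right (by positivity)

lemma exists_sum_fiber_rpow_le {ε : ℝ} (hε : 0 < ε) : ∃ W : ℝ, 0 < W ∧
    ∀ (R : Finset (ℤ × ℤ)) (n : ℤ),
      ∑ q ∈ R with q.1 + q.2 = n, (|(q.1 : ℝ)| ^ (-(1 / 2 + 2 * ε))) ^ 2 ≤ W ∧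
      ∑ q ∈ R with q.1 + q.2 = n, (|(q.2 : ℝ)| ^ (-(1 / 2 + 2 * ε))) ^ 2 ≤ W := by
  have hsum : Summable fun k : ℤ => (|(k : ℝ)| ^ (-(1 / 2 + 2 * ε))) ^ 2 := by
    refine (Real.summable_abs_int_rpow (b := 1 + 4 * ε) (by linarith)).congr fun k => ?_
    rw [← Real.rpow_mul_natCast (abs_nonneg _)]
    ring_nf
  have hle : ∀ (R : Finset (ℤ × ℤ)) (pr : ℤ × ℤ → ℤ), Set.InjOn pr R →
      ∑ q ∈ R, (|(pr q : ℝ)| ^ (-(1 / 2 + 2 * ε))) ^ 2 ≤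
        ∑' k : ℤ, (|(k : ℝ)| ^ (-(1 / 2 + 2 * ε))) ^ 2 := by
    intro R pr hinj
    rw [← Finset.sum_image (f := fun k : ℤ => (|(k : ℝ)| ^ (-(1 / 2 + 2 * ε))) ^ 2) hinj]
    exact hsum.sum_le_tsum _ fun k _ => by positivity
  refine ⟨∑' k : ℤ, (|(k : ℝ)| ^ (-(1 / 2 + 2 * ε))) ^ 2,
    hsum.tsum_pos (fun k => by positivity) 1 (by simp), fun R n => ⟨hle _ Prod.fst ?_, hle _ Prod.snd ?_⟩⟩
  all_goals
    intro q hq r hr h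
    simp only [Finset.coe_filter, Set.mem_ofPred_eq] at hq hr
    refine Prod.ext ?_ ?_ <;> omega

lemma sum_sq_sum_fiber_le (S T : Finset ℤ) (P Q : ℤ → ℝ) (ω : ℤ × ℤ → ℝ) {W : ℝ}
    (hω : ∀ n : ℤ, ∑ q ∈ S ×ˢ T with q.1 + q.2 = n, ω q ^ 2 ≤ W) :
    ∑ n ∈ (S ×ˢ T).image (fun q => q.1 + q.2),
        (∑ q ∈ S ×ˢ T with q.1 + q.2 = n, P q.1 * Q q.2 * ω q) ^ 2 ≤
      W * ((∑ j ∈ S, P j ^ 2) * ∑ k ∈ T, Q k ^ 2) := by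
  calc _ ≤ ∑ n ∈ (S ×ˢ T).image (fun q => q.1 + q.2),
        W * ∑ q ∈ S ×ˢ T with q.1 + q.2 = n, (P q.1 * Q q.2) ^ 2 := by
        refine Finset.sum_le_sum fun n _ => (Finset.sum_mul_sq_le_sq_mul_sq _ _ _).trans ?_
        rw [mul_comm]
        exact mul_le_mul_of_nonneg_right (hω n) (Finset.sum_nonneg fun q _ => sq_nonneg _)
    _ = W * ∑ q ∈ S ×ˢ T, (P q.1 * Q q.2) ^ 2 := by
        rw [← Finset.mul_sum, Finset.sum_fiberwise_of_maps_to fun q hq =>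
          Finset.mem_image_of_mem (fun q : ℤ × ℤ => q.1 + q.2) hq]
    _ = _ := by
        simp only [mul_pow]
        rw [Finset.sum_mul_sum, ← Finset.sum_product']

/-- The `Ḣ^s` estimate
`‖d_{1/2}u·d_{1/2}v‖_{Ḣ^s} ≲ ‖(-Δ)^{1/4+s/2+ε}u‖_{L²}‖(-Δ)^{1/2}v‖_{L²}
 + ‖(-Δ)^{1/2}u‖_{L²}‖(-Δ)^{1/4+s/2+ε}v‖_{L²}` for trigonometric polynomials. -/
theorem d12prod_sobolev_estimate (s ε : ℝ) (hs : 0 < s) (hε : 0 < ε) :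
    ∃ C : ℝ, 0 < C ∧
      ∀ u v : ℝ → ℝ, IsTrigPoly u → IsTrigPoly v →
        (∑' n : ℤ, |(n : ℝ)| ^ (2 * s) * ‖fc (d12prod u v) n‖ ^ 2)
          ≤ C * ((∑' j : ℤ, |(j : ℝ)| ^ (1 + 2 * s + 4 * ε) * ‖fcR u j‖ ^ 2)
                  * (∑' j : ℤ, (j : ℝ) ^ 2 * ‖fcR v j‖ ^ 2)
              + (∑' j : ℤ, (j : ℝ) ^ 2 * ‖fcR u j‖ ^ 2)
                  * (∑' j : ℤ, |(j : ℝ)| ^ (1 + 2 * s + 4 * ε) * ‖fcR v j‖ ^ 2)) := by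
  obtain ⟨W, hW, hWT⟩ := exists_sum_fiber_rpow_le hε
  refine ⟨2 * (2 * π * 2 ^ s) ^ 2 * W, by positivity, ?_⟩
  rintro u v ⟨S, hu⟩ ⟨T, hv⟩
  have hLHS : ∀ n : ℤ, n ∉ (S ×ˢ T).image (fun q => q.1 + q.2) →
      |(n : ℝ)| ^ (2 * s) * ‖fc (d12prod u v) n‖ ^ 2 = 0 := by
    intro n hn
    have h0 := norm_fc_d12prod_le hu hv n
    rw [Finset.filter_false_of_mem fun q hq h => hn (Finset.mem_image.mpr ⟨q, hq, h⟩),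
      Finset.sum_empty] at h0
    simp [norm_le_zero_iff.mp h0]
  have hsum : ∀ {f : ℝ → ℝ} {R : Finset ℤ} (g : ℤ → ℝ), (∀ n ∉ R, fcR f n = 0) →
      ∑' j : ℤ, g j * ‖fcR f j‖ ^ 2 = ∑ j ∈ R, g j * ‖fcR f j‖ ^ 2 := by
    intro f R g h
    exact tsum_eq_sum fun n hn => by simp [h n hn]
  rw [tsum_eq_sum hLHS, hsum _ fun n => fcR_eq_zero hu, hsum _ fun n => fcR_eq_zero hu,
    hsum _ fun n => fcR_eq_zero hv, hsum _ fun n => fcR_eq_zero hv]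
  have hsq : ∀ (R : Finset ℤ) (f : ℝ → ℝ),
      ∑ j ∈ R, |(j : ℝ)| ^ (1 + 2 * s + 4 * ε) * ‖fcR f j‖ ^ 2 =
        ∑ j ∈ R, (|(j : ℝ)| ^ (1 / 2 + 2 * ε + s) * ‖fcR f j‖) ^ 2 := by
    intro R f
    refine Finset.sum_congr rfl fun j _ => ?_
    rw [mul_pow, ← Real.rpow_mul_natCast (abs_nonneg _)]
    ring_nf
  have hsq' : ∀ (R : Finset ℤ) (f : ℝ → ℝ),
      ∑ j ∈ R, (j : ℝ) ^ 2 * ‖fcR f j‖ ^ 2 = ∑ j ∈ R, (|(j : ℝ)| * ‖fcR f j‖) ^ 2 := by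
    intro R f
    simp only [mul_pow, sq_abs]
  rw [hsq, hsq, hsq', hsq']
  have hX := sum_sq_sum_fiber_le S T (fun j => |(j : ℝ)| ^ (1 / 2 + 2 * ε + s) * ‖fcR u j‖)
    (fun k => |(k : ℝ)| * ‖fcR v k‖) (fun q => |(q.2 : ℝ)| ^ (-(1 / 2 + 2 * ε)))
    (fun n => (hWT (S ×ˢ T) n).2)
  have hY := sum_sq_sum_fiber_le S T (fun j => |(j : ℝ)| * ‖fcR u j‖)
    (fun k => |(k : ℝ)| ^ (1 / 2 + 2 * ε + s) * ‖fcR v k‖)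
    (fun q => |(q.1 : ℝ)| ^ (-(1 / 2 + 2 * ε))) (fun n => (hWT (S ×ˢ T) n).1)
  refine le_trans ?_ (le_trans (mul_le_mul_of_nonneg_left (add_le_add hX hY)
    (by positivity : 0 ≤ 2 * (2 * π * 2 ^ s) ^ 2)) (le_of_eq (by ring)))
  rw [← Finset.sum_add_distrib, Finset.mul_sum]
  refine Finset.sum_le_sum fun n _ => ?_
  rw [mul_comm 2 ((2 * π * 2 ^ s) ^ 2), mul_assoc]
  refine le_trans ?_ (mul_le_mul_of_nonneg_left add_sq_le (by positivity))
  rw [mul_comm 2 s, Real.rpow_mul (abs_nonneg _), Real.rpow_two, ← mul_pow, ← mul_pow]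
  refine pow_le_pow_left₀ (by positivity) ?_ 2
  refine (mul_le_mul_of_nonneg_left (norm_fc_d12prod_le hu hv n) (by positivity)).trans ?_
  rw [← Finset.sum_add_distrib, Finset.mul_sum, Finset.mul_sum]
  refine Finset.sum_le_sum fun q hq => ?_
  have hqn : |(n : ℝ)| ≤ |(q.1 : ℝ)| + |(q.2 : ℝ)| := by
    rw [← (Finset.mem_filter.mp hq).2]
    push_cast
    exact abs_add_le _ _
  have hkey := mul_le_mul_of_nonneg_right (rpow_mul_min_le hs.le (by positivity : 0 ≤ 1 / 2 + 2 * ε)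
    (abs_nonneg (q.1 : ℝ)) (abs_nonneg (q.2 : ℝ)) (abs_nonneg (n : ℝ)) hqn)
    (by positivity : 0 ≤ 2 * π * (‖fcR u q.1‖ * ‖fcR v q.2‖))
  refine le_trans (le_of_eq (by ring)) (hkey.trans (le_of_eq (by ring)))
end
end

section
/- Let n ≥ 2 and let u : S¹ → S^{n−1} ⊂ ℝⁿ be measurable with finite Gagliardo energy ∫_{S¹}∫_{S¹}|u(x)−u(y)|²/|x−y|² dy dx < ∞. Then there exists a sequence of maps u_k ∈ C^∞(S¹;ℝⁿ) with u_k(x) ∈ S^{n−1} for all x, such that ‖u_k − u‖_{L²(S¹)} → 0 and ∫_{S¹}∫_{S¹} |(u_k−u)(x)−(u_k−u)(y)|²/|x−y|² dy dx → 0 as k → ∞; that is, smooth S^{n−1}-valued maps are strongly dense in H^{1/2}(S¹;S^{n−1}). -/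
open MeasureTheory Real Filter
open scoped BigOperators ENNReal Real Topology

noncomputable section

lemma cd_sub_sub (x y t : ℝ) : cd (x - t) (y - t) = cd x y := by
  simp [cd]

lemma cd_periodic_left (y : ℝ) : Function.Periodic (fun x => cd x y) (2 * π) := by
  intro x
  have h : (x + 2 * π - y) / 2 = (x - y) / 2 + π := by ring
  simp [cd, h, Real.sin_add_pi]

lemma cd_comm (x y : ℝ) : cd x y = cd y x := by
  have h : (x - y) / 2 = -((y - x) / 2) := by ring
  simp [cd, h]

lemma cd_periodic_right (x : ℝ) : Function.Periodic (cd x) (2 * π) := by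
  intro y
  rw [cd_comm x, cd_comm x]
  exact cd_periodic_left x y

lemma cd_nonneg (x y : ℝ) : 0 ≤ cd x y := by
  unfold cd; positivity

lemma cd_le (x y : ℝ) : cd x y ≤ |x - y| := by
  have h := Real.abs_sin_le_abs (x := (x - y) / 2)
  rw [abs_div, abs_two] at h
  unfold cd
  linarith

lemma cd_pos {x y : ℝ} (hne : x ≠ y) (h : |x - y| < 2 * π) : 0 < cd x y := by
  have h0 : Real.sin ((x - y) / 2) ≠ 0 := by
    rw [abs_lt] at h
    intro h'
    have := (Real.sin_eq_zero_iff_of_lt_of_lt (by linarith) (by linarith)).1 h'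
    exact hne (by linarith)
  unfold cd
  positivity

@[fun_prop]
lemma Measurable.cd {α : Type*} [MeasurableSpace α] {f g : α → ℝ} (hf : Measurable f)
    (hg : Measurable g) : Measurable fun a => cd (f a) (g a) := by
  unfold _root_.cd
  fun_prop

instance : IsFiniteMeasure (volume.restrict circ) := by
  unfold circ; infer_instance

/-- The lintegral of a `2π`-periodic function over a period is invariant under translation. -/
lemma Function.Periodic.lintegral_circ_sub {f : ℝ → ℝ≥0∞} (hf : Function.Periodic f (2 * π))
    (t : ℝ) : ∫⁻ x in circ, f (x - t) = ∫⁻ x in circ, f x := by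
  have hmp : MeasurePreserving (fun x : ℝ => x - t) volume volume :=
    measurePreserving_sub_right volume t
  have hpre : (fun x : ℝ => x - t) ⁻¹' Set.Ioc (-π - t) (-π - t + 2 * π) = circ := by
    ext x
    simp only [circ, Set.mem_preimage, Set.mem_Ioc]
    constructor <;> rintro ⟨h1, h2⟩ <;> constructor <;> linarith
  rw [← hpre, hmp.setLIntegral_comp_preimage_emb (MeasurableEquiv.subRight t).measurableEmbedding]
  have hc : circ = Set.Ioc (-π) (-π + 2 * π) := by
    unfold circ; congr 1; ring
  rw [hpre, hc]
  exact (isAddFundamentalDomain_Ioc Real.two_pi_pos _).setLIntegral_eq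
    (isAddFundamentalDomain_Ioc Real.two_pi_pos _) f hf.map_vadd_zmultiples

lemma Function.Periodic.lintegral_circ_rsub {f : ℝ → ℝ≥0∞} (hf : Function.Periodic f (2 * π))
    (t : ℝ) : ∫⁻ x in circ, f (t - x) = ∫⁻ x in circ, f x := by
  have hpre : (fun x : ℝ => t - x) ⁻¹' Set.Ico (t - π) (t - π + 2 * π) = circ := by
    ext x
    simp only [circ, Set.mem_preimage, Set.mem_Ioc, Set.mem_Ico]
    constructor <;> rintro ⟨h1, h2⟩ <;> constructor <;> linarith
  have hmp : MeasurePreserving (fun x : ℝ => t - x) volume volume :=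
    Measure.measurePreserving_sub_left volume t
  rw [← hpre, hmp.setLIntegral_comp_preimage_emb (MeasurableEquiv.subLeft t).measurableEmbedding]
  have hc : circ = Set.Ioc (-π) (-π + 2 * π) := by
    unfold circ; congr 1; ring
  rw [hpre, hc, setLIntegral_congr Ico_ae_eq_Ioc]
  exact (isAddFundamentalDomain_Ioc Real.two_pi_pos _).setLIntegral_eq
    (isAddFundamentalDomain_Ioc Real.two_pi_pos _) f hf.map_vadd_zmultiples

/-- The integrand of the squared Gagliardo seminorm. -/
def gagliardoIntegrand {n : ℕ} (u : ℝ → E n) (x y : ℝ) : ℝ≥0∞ :=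
  ENNReal.ofReal (‖u x - u y‖ ^ 2 / cd x y ^ 2)

/-- The squared Gagliardo seminorm on the circle. -/
def gagliardo {n : ℕ} (u : ℝ → E n) : ℝ≥0∞ :=
  ∫⁻ x in circ, ∫⁻ y in circ, gagliardoIntegrand u x y

@[fun_prop]
lemma Measurable.gagliardoIntegrand {n : ℕ} {α : Type*} [MeasurableSpace α] {u : ℝ → E n}
    (hu : Measurable u) {f g : α → ℝ} (hf : Measurable f) (hg : Measurable g) :
    Measurable fun a => gagliardoIntegrand u (f a) (g a) := by
  unfold _root_.gagliardoIntegrand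
  fun_prop

lemma gagliardoIntegrand_periodic_left {n : ℕ} {u : ℝ → E n} (hu : Function.Periodic u (2 * π))
    (y : ℝ) : Function.Periodic (fun x => gagliardoIntegrand u x y) (2 * π) := by
  intro x
  have h := cd_periodic_left y x
  simp only at h
  simp only [gagliardoIntegrand, hu x, h]

lemma gagliardoIntegrand_periodic_right {n : ℕ} {u : ℝ → E n} (hu : Function.Periodic u (2 * π))
    (x : ℝ) : Function.Periodic (gagliardoIntegrand u x) (2 * π) := by
  intro y
  simp only [gagliardoIntegrand, hu y, cd_periodic_right x y]

lemma lintegral_circ_circ_sub {H : ℝ → ℝ → ℝ≥0∞}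
    (hl : ∀ y, Function.Periodic (fun x => H x y) (2 * π))
    (hr : ∀ x, Function.Periodic (H x) (2 * π)) (t : ℝ) :
    ∫⁻ x in circ, ∫⁻ y in circ, H (x - t) (y - t) = ∫⁻ x in circ, ∫⁻ y in circ, H x y := by
  have h1 (x : ℝ) : ∫⁻ y in circ, H (x - t) (y - t) = ∫⁻ y in circ, H (x - t) y :=
    (hr (x - t)).lintegral_circ_sub t
  simp_rw [h1]
  refine Function.Periodic.lintegral_circ_sub (f := fun x => ∫⁻ y in circ, H x y) (fun x => ?_) t
  exact lintegral_congr fun y => hl y x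

lemma lintegral_circ_circ_rsub {H : ℝ → ℝ → ℝ≥0∞}
    (hl : ∀ y, Function.Periodic (fun x => H x y) (2 * π))
    (hr : ∀ x, Function.Periodic (H x) (2 * π)) (t : ℝ) :
    ∫⁻ x in circ, ∫⁻ y in circ, H (t - x) (t - y) = ∫⁻ x in circ, ∫⁻ y in circ, H x y := by
  have h1 (x : ℝ) : ∫⁻ y in circ, H (t - x) (t - y) = ∫⁻ y in circ, H (t - x) y :=
    (hr (t - x)).lintegral_circ_rsub t
  simp_rw [h1]
  refine Function.Periodic.lintegral_circ_rsub (f := fun x => ∫⁻ y in circ, H x y) (fun x => ?_) t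
  exact lintegral_congr fun y => hl y x

/-- Two functions agreeing almost everywhere on the circle have the same Gagliardo seminorm. -/
lemma gagliardo_congr_ae {n : ℕ} {u v : ℝ → E n} (h : u =ᵐ[volume.restrict circ] v) :
    gagliardo u = gagliardo v := by
  refine lintegral_congr_ae ?_
  filter_upwards [h] with x hx
  refine lintegral_congr_ae ?_
  filter_upwards [h] with y hy
  simp [gagliardoIntegrand, hx, hy]

lemma gagliardo_sub_add_gagliardo_add {n : ℕ} {u v : ℝ → E n} (hu : Measurable u)
    (hv : Measurable v) :
    gagliardo (v - u) + gagliardo (v + u) = 2 * (gagliardo v + gagliardo u) := by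
  have hp (x y : ℝ) : gagliardoIntegrand (v - u) x y + gagliardoIntegrand (v + u) x y =
      2 * (gagliardoIntegrand v x y + gagliardoIntegrand u x y) := by
    have hpar := parallelogram_law_with_norm ℝ (v x - v y) (u x - u y)
    simp only [gagliardoIntegrand, Pi.sub_apply, Pi.add_apply]
    rw [← ENNReal.ofReal_add (by positivity) (by positivity),
      ← ENNReal.ofReal_add (by positivity) (by positivity), two_mul,
      ← ENNReal.ofReal_add (by positivity) (by positivity),
      sub_sub_sub_comm, add_sub_add_comm]
    congr 1
    rw [← add_div, ← add_div, ← add_div]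
    congr 1
    linarith
  unfold gagliardo
  rw [← lintegral_add_left (by fun_prop), ← lintegral_add_left (by fun_prop),
    ← lintegral_const_mul _ (by fun_prop)]
  refine lintegral_congr fun x => ?_
  rw [← lintegral_add_left (by fun_prop), ← lintegral_add_left (by fun_prop),
    ← lintegral_const_mul _ (by fun_prop)]
  exact lintegral_congr fun y => hp x y

lemma gagliardo_two_smul {n : ℕ} {u : ℝ → E n} (hu : Measurable u) :
    gagliardo (u + u) = 4 * gagliardo u := by
  unfold gagliardo
  rw [← lintegral_const_mul _ (by fun_prop)]
  refine lintegral_congr fun x => ?_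
  rw [← lintegral_const_mul _ (by fun_prop)]
  refine lintegral_congr fun y => ?_
  simp only [gagliardoIntegrand, Pi.add_apply]
  rw [← ENNReal.ofReal_ofNat 4, ← ENNReal.ofReal_mul (by norm_num), add_sub_add_comm, ← two_smul ℝ,
    norm_smul, mul_pow]
  norm_num [mul_div_assoc]

/-- Lower semicontinuity of the Gagliardo seminorm under almost everywhere convergence. -/
lemma gagliardo_le_liminf {n : ℕ} {u : ℝ → E n} {v : ℕ → ℝ → E n} (hv : ∀ k, Measurable (v k))
    (h : ∀ᵐ x ∂volume.restrict circ, Tendsto (fun k => v k x) atTop (𝓝 (u x))) :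
    gagliardo u ≤ liminf (fun k => gagliardo (v k)) atTop := by
  refine le_trans ?_ (lintegral_liminf_le fun k => by fun_prop)
  refine lintegral_mono_ae ?_
  filter_upwards [h] with x hx
  refine le_trans ?_ (lintegral_liminf_le fun k => by fun_prop)
  refine lintegral_mono_ae ?_
  filter_upwards [h] with y hy
  refine (Tendsto.liminf_eq ?_).ge
  exact ENNReal.tendsto_ofReal (((hx.sub hy).norm.pow 2).div_const _)

lemma ENNReal.tendsto_zero_of_add_le {a b c : ℕ → ℝ≥0∞} {L : ℝ≥0∞} (hL : L ≠ ⊤)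
    (habc : ∀ k, a k + b k ≤ c k) (hc : Tendsto c atTop (𝓝 L)) (hb : L ≤ liminf b atTop) :
    Tendsto a atTop (𝓝 0) := by
  rw [ENNReal.tendsto_nhds_zero]
  intro e he
  rcases eq_or_ne e ⊤ with rfl | he'
  · simp
  have he2 : 0 < e / 2 := ENNReal.half_pos he.ne'
  have he2' : e / 2 ≠ ⊤ := (ENNReal.div_lt_top he' (by norm_num)).ne
  have h1 : ∀ᶠ k in atTop, c k < L + e / 2 :=
    hc.eventually_lt_const (ENNReal.lt_add_right hL he2.ne')
  have h2 : ∀ᶠ k in atTop, L < b k + e / 2 := by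
    rcases eq_or_ne L 0 with rfl | hL0
    · exact Eventually.of_forall fun k => he2.trans_le le_add_self
    · filter_upwards [eventually_lt_of_lt_liminf
        ((ENNReal.sub_lt_self hL hL0 he2.ne').trans_le hb)] with k hk
      exact le_tsub_add.trans_lt (ENNReal.add_lt_add_right he2' hk)
  filter_upwards [h1, h2] with k hk1 hk2
  have hbt : b k ≠ ⊤ := ne_top_of_le_ne_top
    (hk1.trans (ENNReal.add_lt_top.2 ⟨hL.lt_top, he2'.lt_top⟩)).ne (le_add_self.trans (habc k))
  refine (ENNReal.add_le_add_iff_right hbt).1 ((habc k).trans (hk1.le.trans ?_))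
  calc L + e / 2 ≤ b k + e / 2 + e / 2 := by gcongr
    _ = e + b k := by rw [add_assoc, ENNReal.add_halves, add_comm]

/-- Almost everywhere convergence together with convergence of the energies to the energy of the
limit implies strong convergence of the Gagliardo seminorms. -/
lemma tendsto_gagliardo_sub {n : ℕ} {u : ℝ → E n} {v : ℕ → ℝ → E n} (hu : Measurable u)
    (hv : ∀ k, Measurable (v k)) (hfin : gagliardo u ≠ ⊤)
    (h : ∀ᵐ x ∂volume.restrict circ, Tendsto (fun k => v k x) atTop (𝓝 (u x)))
    {r : ℕ → ℝ≥0∞} (hr : Tendsto r atTop (𝓝 1)) (hle : ∀ k, gagliardo (v k) ≤ r k * gagliardo u) :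
    Tendsto (fun k => gagliardo (v k - u)) atTop (𝓝 0) := by
  refine ENNReal.tendsto_zero_of_add_le (L := 4 * gagliardo u)
    (b := fun k => gagliardo (v k + u)) (c := fun k => 2 * (r k * gagliardo u + gagliardo u))
    (ENNReal.mul_ne_top (by norm_num) hfin) (fun k => ?_) ?_ ?_
  · rw [gagliardo_sub_add_gagliardo_add hu (hv k)]
    gcongr
    exact hle k
  · have h4 : 4 * gagliardo u = 2 * (1 * gagliardo u + gagliardo u) := by ring
    rw [h4]
    exact ENNReal.Tendsto.const_mul ((ENNReal.Tendsto.mul_const hr (Or.inr hfin)).add_const _)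
      (Or.inr (by norm_num))
  · rw [← gagliardo_two_smul hu]
    refine gagliardo_le_liminf (fun k => (hv k).add hu) ?_
    filter_upwards [h] with x hx
    exact hx.add_const (u x)

/-- The average of the translates of `u` with respect to `ν`. -/
def translateAverage {n : ℕ} (ν : Measure ℝ) (u : ℝ → E n) (x : ℝ) : E n :=
  ∫ t, u (x - t) ∂ν

lemma translateAverage_periodic {n : ℕ} (ν : Measure ℝ) {u : ℝ → E n}
    (hp : Function.Periodic u (2 * π)) : Function.Periodic (translateAverage ν u) (2 * π) := by
  intro x
  refine integral_congr_ae (Eventually.of_forall fun t => ?_)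
  have h : x + 2 * π - t = x - t + 2 * π := by ring
  simp only [h, hp (x - t)]

lemma integrable_of_norm_le {n : ℕ} {ν : Measure ℝ} [IsFiniteMeasure ν] {f : ℝ → E n}
    (hf : Measurable f) {C : ℝ} (hC : ∀ t, ‖f t‖ ≤ C) : Integrable f ν :=
  Integrable.of_bound hf.aestronglyMeasurable C (Eventually.of_forall hC)

/-- Jensen's inequality for the squared norm. -/
lemma ofReal_norm_integral_sq_le {n : ℕ} {ν : Measure ℝ} [IsProbabilityMeasure ν] {f : ℝ → E n}
    (hf : Measurable f) {C : ℝ} (hC : ∀ t, ‖f t‖ ≤ C) :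
    ENNReal.ofReal (‖∫ t, f t ∂ν‖ ^ 2) ≤ ∫⁻ t, ENNReal.ofReal (‖f t‖ ^ 2) ∂ν := by
  have hint : Integrable (fun t => ‖f t‖ ^ 2) ν := by
    refine Integrable.of_bound (by fun_prop) (C ^ 2) (Eventually.of_forall fun t => ?_)
    rw [Real.norm_of_nonneg (by positivity)]
    gcongr
    exact hC t
  have hconv : ConvexOn ℝ Set.univ fun z : E n => ‖z‖ ^ 2 :=
    convexOn_univ_norm.pow (fun _ _ => norm_nonneg _) 2
  rw [← ofReal_integral_eq_lintegral_ofReal hint (Eventually.of_forall fun t => by positivity)]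
  exact ENNReal.ofReal_le_ofReal (hconv.map_integral_le (by fun_prop) isClosed_univ
    (Eventually.of_forall fun _ => Set.mem_univ _) (integrable_of_norm_le hf hC) hint)

/-- Averaging translates does not increase the Gagliardo seminorm. -/
lemma gagliardo_translateAverage_le {n : ℕ} (ν : Measure ℝ) [IsProbabilityMeasure ν]
    {u : ℝ → E n} (hm : Measurable u) (hp : Function.Periodic u (2 * π)) (hu : ∀ x, ‖u x‖ ≤ 1) :
    gagliardo (translateAverage ν u) ≤ gagliardo u := by
  have hJ (x y : ℝ) : gagliardoIntegrand (translateAverage ν u) x y ≤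
      ∫⁻ t, gagliardoIntegrand u (x - t) (y - t) ∂ν := by
    have hx (z : ℝ) : Integrable (fun t => u (z - t)) ν :=
      integrable_of_norm_le (by fun_prop) fun t => hu _
    simp only [gagliardoIntegrand, translateAverage, cd_sub_sub, div_eq_mul_inv]
    rw [← integral_sub (hx x) (hx y)]
    simp_rw [ENNReal.ofReal_mul (sq_nonneg _)]
    rw [lintegral_mul_const _ (by fun_prop)]
    gcongr
    refine ofReal_norm_integral_sq_le (by fun_prop) (C := 2) fun t => ?_
    calc _ ≤ ‖u (x - t)‖ + ‖u (y - t)‖ := norm_sub_le _ _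
      _ ≤ 2 := by linarith [hu (x - t), hu (y - t)]
  calc gagliardo (translateAverage ν u)
      ≤ ∫⁻ x in circ, ∫⁻ y in circ, ∫⁻ t, gagliardoIntegrand u (x - t) (y - t) ∂ν :=
        lintegral_mono fun x => lintegral_mono fun y => hJ x y
    _ = ∫⁻ x in circ, ∫⁻ t, (∫⁻ y in circ, gagliardoIntegrand u (x - t) (y - t)) ∂ν := by
        refine lintegral_congr fun x => lintegral_lintegral_swap ?_
        simp only [Function.uncurry_def]
        fun_prop
    _ = ∫⁻ t, (∫⁻ x in circ, ∫⁻ y in circ, gagliardoIntegrand u (x - t) (y - t)) ∂ν := by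
        refine lintegral_lintegral_swap ?_
        simp only [Function.uncurry_def]
        refine Measurable.aemeasurable (Measurable.lintegral_prod_right'
          (f := fun p : (ℝ × ℝ) × ℝ => gagliardoIntegrand u (p.1.1 - p.1.2) (p.2 - p.1.2)) ?_)
        fun_prop
    _ = ∫⁻ _, gagliardo u ∂ν := by
        refine lintegral_congr fun t => ?_
        exact lintegral_circ_circ_sub (gagliardoIntegrand_periodic_left hp)
          (gagliardoIntegrand_periodic_right hp) t
    _ = gagliardo u := by simp

/-- The variance identity for a sphere-valued map. -/
lemma ofReal_two_sub_norm_integral_sq {n : ℕ} {ν : Measure ℝ} [IsProbabilityMeasure ν]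
    {f : ℝ → E n} (hf : Measurable f) (h1 : ∀ t, ‖f t‖ = 1) :
    ENNReal.ofReal (2 - 2 * ‖∫ t, f t ∂ν‖ ^ 2) =
      ∫⁻ s, ∫⁻ t, ENNReal.ofReal (‖f s - f t‖ ^ 2) ∂ν ∂ν := by
  have hfi : Integrable f ν := integrable_of_norm_le hf fun t => (h1 t).le
  have hsq (s t : ℝ) : ‖f s - f t‖ ^ 2 = 2 - 2 * inner ℝ (f s) (f t) := by
    rw [norm_sub_sq_real, h1, h1]; ring
  have hint (c : E n) : Integrable (fun t => 2 - 2 * inner ℝ c (f t)) ν :=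
    (integrable_const _).sub ((hfi.const_inner c).const_mul 2)
  have hi (c : E n) : ∫ t, (2 - 2 * inner ℝ c (f t)) ∂ν = 2 - 2 * inner ℝ c (∫ t, f t ∂ν) := by
    rw [integral_sub (integrable_const _) ((hfi.const_inner c).const_mul 2), integral_const_mul,
      integral_inner hfi]
    simp
  have hin (s : ℝ) : ∫⁻ t, ENNReal.ofReal (‖f s - f t‖ ^ 2) ∂ν =
      ENNReal.ofReal (2 - 2 * inner ℝ (∫ t, f t ∂ν) (f s)) := by
    rw [real_inner_comm, ← hi, ofReal_integral_eq_lintegral_ofReal (hint _)]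
    · simp_rw [hsq]
    · exact Eventually.of_forall fun t => by
        simp only [Pi.zero_apply, ← hsq]; positivity
  simp_rw [hin]
  rw [← ofReal_integral_eq_lintegral_ofReal (hint _), hi, real_inner_self_eq_norm_sq]
  refine Eventually.of_forall fun s => ?_
  have hns : ‖∫ t, f t ∂ν‖ ≤ 1 := by
    simpa using norm_integral_le_of_norm_le_const (μ := ν) (Eventually.of_forall fun t => (h1 t).le)
  have := real_inner_le_norm (∫ t, f t ∂ν) (f s)
  rw [h1, mul_one] at this
  simp only [Pi.zero_apply]
  linarith

/-- The Gagliardo integrand restricted to the strip of width `δ` around the diagonal. -/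
def stripIntegrand {n : ℕ} (δ : ℝ) (u : ℝ → E n) (x y : ℝ) : ℝ≥0∞ :=
  if cd x y ≤ δ then gagliardoIntegrand u x y else 0

lemma Measurable.stripIntegrand {n : ℕ} (δ : ℝ) {u : ℝ → E n} (hu : Measurable u) :
    Measurable fun p : ℝ × ℝ => stripIntegrand δ u p.1 p.2 := by
  unfold _root_.stripIntegrand
  exact Measurable.ite (measurableSet_le (by fun_prop) measurable_const) (by fun_prop)
    measurable_const

lemma tendsto_lintegral_stripIntegrand {n : ℕ} {u : ℝ → E n} (hu : Measurable u)
    (hfin : gagliardo u ≠ ⊤) {δ : ℕ → ℝ} (hδ : Tendsto δ atTop (𝓝 0)) :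
    Tendsto (fun k => ∫⁻ x in circ, ∫⁻ y in circ, stripIntegrand (δ k) u x y) atTop (𝓝 0) := by
  have hprod (k : ℕ) : ∫⁻ x in circ, ∫⁻ y in circ, stripIntegrand (δ k) u x y =
      ∫⁻ p, stripIntegrand (δ k) u p.1 p.2
        ∂((volume.restrict circ).prod (volume.restrict circ)) :=
    (lintegral_prod (fun p : ℝ × ℝ => stripIntegrand (δ k) u p.1 p.2)
      (hu.stripIntegrand (δ k)).aemeasurable).symm
  have hg : gagliardo u = ∫⁻ p, gagliardoIntegrand u p.1 p.2
        ∂((volume.restrict circ).prod (volume.restrict circ)) :=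
    (lintegral_prod (fun p : ℝ × ℝ => gagliardoIntegrand u p.1 p.2) (by fun_prop)).symm
  simp_rw [hprod]
  rw [← lintegral_zero (μ := (volume.restrict circ).prod (volume.restrict circ))]
  refine tendsto_lintegral_of_dominated_convergence
    (fun p : ℝ × ℝ => gagliardoIntegrand u p.1 p.2) (fun k => hu.stripIntegrand (δ k))
    (fun k => Eventually.of_forall fun p => ?_) (hg ▸ hfin) (Eventually.of_forall fun p => ?_)
  · simp only [stripIntegrand]
    split_ifs <;> simp
  · rcases (cd_nonneg p.1 p.2).eq_or_lt with h0 | h0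
    · have : ∀ k, stripIntegrand (δ k) u p.1 p.2 = 0 := fun k => by
        simp [stripIntegrand, gagliardoIntegrand, ← h0]
      simp [this]
    · refine tendsto_const_nhds.congr' ?_
      filter_upwards [hδ.eventually_lt_const h0] with k hk
      simp [stripIntegrand, hk.not_ge]

/-- Uniform control of the distance of local averages to the sphere. -/
lemma ofReal_two_sub_norm_translateAverage_sq_le {n : ℕ} {ν : Measure ℝ} [IsProbabilityMeasure ν]
    {u : ℝ → E n} (hm : Measurable u) (hp : Function.Periodic u (2 * π)) (h1 : ∀ x, ‖u x‖ = 1)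
    {ε : ℝ} (hε : 0 < ε) (hεπ : ε < π)
    (hν : ν ≤ ENNReal.ofReal (1 / ε) • volume.restrict (Metric.closedBall 0 ε)) (x : ℝ) :
    ENNReal.ofReal (2 - 2 * ‖translateAverage ν u x‖ ^ 2) ≤
      4 * ∫⁻ y in circ, ∫⁻ z in circ, stripIntegrand (2 * ε) u y z := by
  set c : ℝ≥0∞ := ENNReal.ofReal (1 / ε)
  set B : Set ℝ := Metric.closedBall 0 ε
  have hB : B ⊆ circ := by
    intro t ht
    simp only [B, Metric.mem_closedBall, dist_zero_right, Real.norm_eq_abs, abs_le] at ht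
    exact ⟨by linarith, by linarith⟩
  have hBm : MeasurableSet B := Metric.isClosed_closedBall.measurableSet
  have hle (f : ℝ → ℝ≥0∞) : ∫⁻ t, f t ∂ν ≤ c * ∫⁻ t in B, f t := by
    refine (lintegral_mono' hν le_rfl).trans_eq ?_
    rw [lintegral_smul_measure, smul_eq_mul]
  have hc : c * c * ENNReal.ofReal (4 * ε ^ 2) = 4 := by
    rw [← ENNReal.ofReal_mul (by positivity), ← ENNReal.ofReal_mul (by positivity)]
    rw [show 1 / ε * (1 / ε) * (4 * ε ^ 2) = 4 by field_simp]
    simp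
  have hpt {s t : ℝ} (hs : s ∈ B) (ht : t ∈ B) : ENNReal.ofReal (‖u (x - s) - u (x - t)‖ ^ 2) ≤
      ENNReal.ofReal (4 * ε ^ 2) * stripIntegrand (2 * ε) u (x - s) (x - t) := by
    simp only [B, Metric.mem_closedBall, dist_zero_right, Real.norm_eq_abs, abs_le] at hs ht
    rcases eq_or_ne s t with rfl | hst
    · simp
    have habs : |x - s - (x - t)| ≤ 2 * ε := abs_le.2 ⟨by linarith, by linarith⟩
    have hcd := (cd_le (x - s) (x - t)).trans habs
    have hpos : 0 < cd (x - s) (x - t) :=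
      cd_pos (fun h => hst (by linarith)) (habs.trans_lt (by linarith))
    rw [stripIntegrand, if_pos hcd, gagliardoIntegrand, ← ENNReal.ofReal_mul (by positivity)]
    refine ENNReal.ofReal_le_ofReal ?_
    rw [mul_div_assoc', le_div_iff₀ (by positivity), mul_comm]
    gcongr
    nlinarith
  have hper : ∫⁻ s in circ, ∫⁻ t in circ, stripIntegrand (2 * ε) u (x - s) (x - t) =
      ∫⁻ y in circ, ∫⁻ z in circ, stripIntegrand (2 * ε) u y z := by
    refine lintegral_circ_circ_rsub (fun y z => ?_) (fun y z => ?_) x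
    · have h2 := cd_periodic_left y z
      have h3 := gagliardoIntegrand_periodic_left hp y z
      simp only at h2 h3
      simp only [stripIntegrand, h2, h3]
    · simp only [stripIntegrand, cd_periodic_right y z, gagliardoIntegrand_periodic_right hp y z]
  calc ENNReal.ofReal (2 - 2 * ‖translateAverage ν u x‖ ^ 2)
      = ∫⁻ s, ∫⁻ t, ENNReal.ofReal (‖u (x - s) - u (x - t)‖ ^ 2) ∂ν ∂ν :=
        ofReal_two_sub_norm_integral_sq (f := fun t => u (x - t)) (by fun_prop) fun t => h1 _
    _ ≤ c * ∫⁻ s in B, c * ∫⁻ t in B, ENNReal.ofReal (‖u (x - s) - u (x - t)‖ ^ 2) := by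
        refine (hle _).trans ?_
        gcongr with s
        exact hle _
    _ ≤ c * ∫⁻ s in B, c * ∫⁻ t in B, ENNReal.ofReal (4 * ε ^ 2) *
          stripIntegrand (2 * ε) u (x - s) (x - t) := by
        refine mul_le_mul_right (setLIntegral_mono' hBm fun s hs => ?_) _
        exact mul_le_mul_right (setLIntegral_mono' hBm fun t ht => hpt hs ht) _
    _ = 4 * ∫⁻ s in B, ∫⁻ t in B, stripIntegrand (2 * ε) u (x - s) (x - t) := by
        simp_rw [lintegral_const_mul' _ _ ENNReal.ofReal_ne_top]
        rw [lintegral_const_mul' _ _ ENNReal.ofReal_ne_top,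
          lintegral_const_mul' _ _ ENNReal.ofReal_ne_top, ← hc]
        ring
    _ ≤ 4 * ∫⁻ s in circ, ∫⁻ t in circ, stripIntegrand (2 * ε) u (x - s) (x - t) := by
        gcongr
    _ = _ := by rw [hper]

/-- Radial projection to the sphere is Lipschitz away from the origin. -/
lemma norm_normalize_sub_normalize_sq_le {V : Type*} [NormedAddCommGroup V]
    [InnerProductSpace ℝ V] {a b : V} {r : ℝ} (hr : 0 < r) (ha : r ≤ ‖a‖ ^ 2) (hb : r ≤ ‖b‖ ^ 2) :
    ‖‖a‖⁻¹ • a - ‖b‖⁻¹ • b‖ ^ 2 ≤ r⁻¹ * ‖a - b‖ ^ 2 := by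
  have ha0 : 0 < ‖a‖ := (norm_nonneg a).lt_of_ne fun h => by
    rw [← h] at ha
    norm_num at ha
    linarith
  have hb0 : 0 < ‖b‖ := (norm_nonneg b).lt_of_ne fun h => by
    rw [← h] at hb
    norm_num at hb
    linarith
  have hab : r ≤ ‖a‖ * ‖b‖ := by
    refine le_of_sq_le_sq ?_ (by positivity)
    nlinarith
  have hin : inner ℝ a b ≤ ‖a‖ * ‖b‖ := real_inner_le_norm a b
  rw [norm_sub_sq_real, norm_sub_sq_real, norm_smul, norm_smul, inner_smul_left, inner_smul_right]
  simp only [norm_inv, norm_norm, conj_trivial, inv_mul_cancel₀ ha0.ne', inv_mul_cancel₀ hb0.ne']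
  have key : 2 * (‖a‖ * ‖b‖ - inner ℝ a b) / (‖a‖ * ‖b‖) ≤
      (‖a‖ ^ 2 - 2 * inner ℝ a b + ‖b‖ ^ 2) / r := by
    gcongr ?_ / ?_ <;> nlinarith [sq_nonneg (‖a‖ - ‖b‖)]
  calc _ = 2 * (‖a‖ * ‖b‖ - inner ℝ a b) / (‖a‖ * ‖b‖) := by field_simp; ring
    _ ≤ _ := key
    _ = _ := by rw [div_eq_inv_mul]

lemma gagliardo_normalize_le {n : ℕ} {w : ℝ → E n} (hw : Measurable w) {r : ℝ} (hr : 0 < r)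
    (h : ∀ x, r ≤ ‖w x‖ ^ 2) :
    gagliardo (fun x => ‖w x‖⁻¹ • w x) ≤ ENNReal.ofReal r⁻¹ * gagliardo w := by
  unfold gagliardo
  rw [← lintegral_const_mul _ (by fun_prop)]
  refine lintegral_mono fun x => ?_
  rw [← lintegral_const_mul _ (by fun_prop)]
  refine lintegral_mono fun y => ?_
  rw [gagliardoIntegrand, gagliardoIntegrand, ← ENNReal.ofReal_mul (by positivity),
    ← mul_div_assoc]
  gcongr
  exact norm_normalize_sub_normalize_sq_le hr (h x) (h y)

/-- The probability measure with density the normalised bump function `φ`. -/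
def bumpMeasure (φ : ContDiffBump (0 : ℝ)) : Measure ℝ :=
  volume.withDensity fun t => ENNReal.ofReal (φ.normed volume t)

instance (φ : ContDiffBump (0 : ℝ)) : IsProbabilityMeasure (bumpMeasure φ) := by
  refine ⟨?_⟩
  rw [bumpMeasure, withDensity_apply _ MeasurableSet.univ, Measure.restrict_univ,
    ← ofReal_integral_eq_lintegral_ofReal φ.integrable_normed
      (Eventually.of_forall φ.nonneg_normed), φ.integral_normed, ENNReal.ofReal_one]

lemma translateAverage_bumpMeasure {n : ℕ} (φ : ContDiffBump (0 : ℝ)) (u : ℝ → E n) :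
    translateAverage (bumpMeasure φ) u =
      convolution (φ.normed volume) u (ContinuousLinearMap.lsmul ℝ ℝ) volume := by
  ext1 x
  rw [translateAverage, bumpMeasure, integral_withDensity_eq_integral_toReal_smul
    φ.continuous_normed.measurable.ennreal_ofReal (Eventually.of_forall fun _ => by simp)]
  simp [convolution, ENNReal.toReal_ofReal (φ.nonneg_normed _)]

lemma bumpMeasure_le (φ : ContDiffBump (0 : ℝ)) {ε : ℝ} (hin : φ.rIn = ε / 2)
    (hout : φ.rOut = ε) :
    bumpMeasure φ ≤ ENNReal.ofReal (1 / ε) • volume.restrict (Metric.closedBall 0 ε) := by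
  have hB : MeasurableSet (Metric.closedBall (0 : ℝ) ε) :=
    Metric.isClosed_closedBall.measurableSet
  rw [← withDensity_const, ← withDensity_indicator hB]
  refine withDensity_mono (Eventually.of_forall fun t => ?_)
  by_cases ht : t ∈ Metric.closedBall (0 : ℝ) ε
  · rw [Set.indicator_of_mem ht]
    refine ENNReal.ofReal_le_ofReal ((φ.normed_le_div_measure_closedBall_rIn volume t).trans_eq ?_)
    rw [Real.volume_real_closedBall φ.rIn_pos.le, hin]
    ring
  · have h0 : φ.normed volume t = 0 := by
      rw [← Function.notMem_support, φ.support_normed_eq, hout]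
      exact fun h => ht (Metric.ball_subset_closedBall h)
    simp [h0]

/-- The bump function at the origin of outer radius `ε` and inner radius `ε / 2`. -/
def halfBump {ε : ℝ} (hε : 0 < ε) : ContDiffBump (0 : ℝ) where
  rIn := ε / 2
  rOut := ε
  rIn_pos := half_pos hε
  rIn_lt_rOut := half_lt_self hε

/-- Strong density of smooth maps for a map taking values in the sphere at every point. -/
lemma exists_smooth_sphere_approx {n : ℕ} {u : ℝ → E n} (hm : Measurable u)
    (hp : Function.Periodic u (2 * π)) (h1 : ∀ x, ‖u x‖ = 1) (hfin : gagliardo u ≠ ⊤) :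
    ∃ v : ℕ → ℝ → E n, (∀ k, ContDiff ℝ (⊤ : ℕ∞) (v k)) ∧
      (∀ k, Function.Periodic (v k) (2 * π)) ∧ (∀ k x, ‖v k x‖ = 1) ∧
      (∀ᵐ x ∂volume.restrict circ, Tendsto (fun k => v k x) atTop (𝓝 (u x))) ∧
      Tendsto (fun k => gagliardo (v k - u)) atTop (𝓝 0) := by
  have hloc : LocallyIntegrable u volume :=
    (locallyIntegrable_const (1 : ℝ)).mono hm.aestronglyMeasurable
      (Eventually.of_forall fun x => by simp [h1])
  have hε (k : ℕ) : 0 < 1 / ((k : ℝ) + 1) := by positivity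
  have hεlim : Tendsto (fun k : ℕ => 1 / ((k : ℝ) + 1)) atTop (𝓝 0) :=
    tendsto_one_div_add_atTop_nhds_zero_nat
  have hεπ (k : ℕ) : 1 / ((k : ℝ) + 1) < π := by
    have : 1 / ((k : ℝ) + 1) ≤ 1 := by
      rw [div_le_one (by positivity)]
      linarith [(k.cast_nonneg : (0 : ℝ) ≤ k)]
    linarith [Real.pi_gt_three]
  set w : ℕ → ℝ → E n := fun k => translateAverage (bumpMeasure (halfBump (hε k))) u with hw
  have hwc (k : ℕ) : ContDiff ℝ (⊤ : ℕ∞) (w k) := by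
    simp only [hw, translateAverage_bumpMeasure]
    exact (halfBump (hε k)).hasCompactSupport_normed.contDiff_convolution_left _
      (halfBump (hε k)).contDiff_normed hloc
  have hwlim : ∀ᵐ x, Tendsto (fun k => w k x) atTop (𝓝 (u x)) := by
    simp only [hw, translateAverage_bumpMeasure]
    refine ContDiffBump.ae_convolution_tendsto_right_of_locallyIntegrable (K := 2) hεlim
      (Eventually.of_forall fun k => ?_) hloc
    simp only [halfBump]
    linarith
  set η : ℕ → ℝ≥0∞ := fun k =>
    4 * ∫⁻ y in circ, ∫⁻ z in circ, stripIntegrand (2 * (1 / ((k : ℝ) + 1))) u y z with hη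
  have hηlim : Tendsto η atTop (𝓝 0) := by
    have h := tendsto_lintegral_stripIntegrand hm hfin
      (δ := fun k => 2 * (1 / ((k : ℝ) + 1))) (by simpa using hεlim.const_mul 2)
    simpa [hη] using ENNReal.Tendsto.const_mul h (Or.inr (by norm_num : (4 : ℝ≥0∞) ≠ ⊤))
  have hwη (k : ℕ) (x : ℝ) : ENNReal.ofReal (2 - 2 * ‖w k x‖ ^ 2) ≤ η k :=
    ofReal_two_sub_norm_translateAverage_sq_le hm hp h1 (hε k) (hεπ k)
      (bumpMeasure_le _ rfl rfl) x
  obtain ⟨N, hN⟩ := eventually_atTop.1 (hηlim.eventually_lt_const (zero_lt_one (α := ℝ≥0∞)))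
  have hηN (k : ℕ) : η (k + N) < 1 := hN _ (Nat.le_add_left N k)
  set r : ℕ → ℝ := fun k => 1 - (η (k + N)).toReal / 2 with hr
  have hrlow (k : ℕ) : 1 / 2 ≤ r k := by
    have := ENNReal.toReal_mono ENNReal.one_ne_top (hηN k).le
    simp only [ENNReal.toReal_one] at this
    simp only [hr]
    linarith
  have hrpos (k : ℕ) : 0 < r k := by linarith [hrlow k]
  have hrw (k : ℕ) (x : ℝ) : r k ≤ ‖w (k + N) x‖ ^ 2 := by
    have := (ENNReal.ofReal_le_iff_le_toReal (hηN k).ne_top).1 (hwη (k + N) x)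
    simp only [hr]
    linarith
  have hrlim : Tendsto r atTop (𝓝 1) := by
    have h := (ENNReal.tendsto_toReal ENNReal.zero_ne_top).comp
      (hηlim.comp (tendsto_add_atTop_nat N))
    simpa using (h.div_const 2).const_sub 1
  have hw0 (k : ℕ) (x : ℝ) : w (k + N) x ≠ 0 := fun h => by
    have := hrw k x
    rw [h] at this
    norm_num at this
    linarith [hrpos k]
  have hvlim : ∀ᵐ x ∂volume.restrict circ,
      Tendsto (fun k => ‖w (k + N) x‖⁻¹ • w (k + N) x) atTop (𝓝 (u x)) := by
    filter_upwards [ae_restrict_of_ae hwlim] with x hx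
    have hx' := hx.comp (tendsto_add_atTop_nat N)
    simpa [h1] using (hx'.norm.inv₀ (by simp [h1])).smul hx'
  refine ⟨fun k x => ‖w (k + N) x‖⁻¹ • w (k + N) x, fun k => ?_, fun k x => ?_, fun k x => ?_,
    hvlim, ?_⟩
  · exact (((hwc _).norm ℝ (hw0 k)).inv fun x => norm_ne_zero_iff.2 (hw0 k x)).smul (hwc _)
  · simp only [translateAverage_periodic _ hp x, hw]
  · rw [norm_smul, norm_inv, norm_norm, inv_mul_cancel₀ (norm_ne_zero_iff.2 (hw0 k x))]
  · have hwm (k : ℕ) : Measurable (w k) := (hwc k).continuous.measurable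
    refine tendsto_gagliardo_sub hm (fun k => by fun_prop) hfin hvlim
      (r := fun k => ENNReal.ofReal (r k)⁻¹) ?_ fun k => ?_
    · simpa using ENNReal.tendsto_ofReal (hrlim.inv₀ one_ne_zero)
    · refine (gagliardo_normalize_le (hwm _) (hrpos k) (hrw k)).trans ?_
      gcongr
      exact gagliardo_translateAverage_le _ hm hp fun x => (h1 x).le

/-- Strong density of smooth `S^{n-1}`-valued maps in
`H^{1/2}(S¹; S^{n-1})` (Schoen–Uhlenbeck type approximation). -/
theorem smooth_density_H12_sphere (n : ℕ) (hn : 2 ≤ n) (u : ℝ → E n)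
    (hm : Measurable u) (hp : Function.Periodic u (2 * π))
    (hs : ∀ᵐ x ∂(volume.restrict circ), ‖u x‖ = 1)
    (hfin : (∫⁻ x in circ, ∫⁻ y in circ,
        ENNReal.ofReal (‖u x - u y‖ ^ 2 / cd x y ^ 2)) < ⊤) :
    ∃ uk : ℕ → ℝ → E n,
      (∀ k, ContDiff ℝ (⊤ : ℕ∞) (uk k)) ∧
      (∀ k, Function.Periodic (uk k) (2 * π)) ∧
      (∀ k x, ‖uk k x‖ = 1) ∧
      Tendsto (fun k => ∫⁻ x in circ, (‖uk k x - u x‖₊ : ℝ≥0∞) ^ 2) atTop (nhds 0) ∧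
      Tendsto (fun k => ∫⁻ x in circ, ∫⁻ y in circ,
          ENNReal.ofReal (‖(uk k x - u x) - (uk k y - u y)‖ ^ 2 / cd x y ^ 2))
        atTop (nhds 0) := by
  classical
  obtain ⟨e, he⟩ : ∃ e : E n, ‖e‖ = 1 := ⟨EuclideanSpace.single ⟨0, by omega⟩ 1, by simp⟩
  set u' : ℝ → E n := fun x => if ‖u x‖ = 1 then u x else e with hu'
  have hm' : Measurable u' :=
    Measurable.ite (measurableSet_eq_fun hm.norm measurable_const) hm measurable_const
  have hp' : Function.Periodic u' (2 * π) := fun x => by simp only [hu', hp x]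
  have h1 (x : ℝ) : ‖u' x‖ = 1 := by
    simp only [hu']
    split_ifs with h
    exacts [h, he]
  have hae : u' =ᵐ[volume.restrict circ] u := by
    filter_upwards [hs] with x hx
    simp [hu', hx]
  obtain ⟨v, hvc, hvp, hv1, hvlim, hvg⟩ := exists_smooth_sphere_approx hm' hp' h1
    ((gagliardo_congr_ae hae).trans_lt hfin).ne
  refine ⟨v, hvc, hvp, hv1, ?_, ?_⟩
  · rw [← lintegral_zero (μ := volume.restrict circ)]
    refine tendsto_lintegral_of_dominated_convergence' (fun _ => 2 ^ 2) (fun k => ?_) (fun k => ?_)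
      ?_ ?_
    · have := (hvc k).continuous.measurable
      fun_prop
    · filter_upwards [hs] with x hx
      gcongr
      refine ENNReal.coe_le_coe.2 (NNReal.coe_le_coe.1 ((norm_sub_le _ _).trans ?_))
      rw [hv1, hx]
      norm_num
    · rw [lintegral_const]
      exact ENNReal.mul_ne_top (by norm_num) (measure_ne_top _ _)
    · filter_upwards [hvlim, hae] with x hx hxe
      rw [hxe] at hx
      have h := (tendsto_iff_norm_sub_tendsto_zero.1 hx)
      have h' : Tendsto (fun k => (‖v k x - u x‖₊ : ℝ≥0∞)) atTop (𝓝 0) := by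
        rw [← ENNReal.coe_zero, ENNReal.tendsto_coe, ← NNReal.tendsto_coe]
        simpa using h
      simpa [Function.comp_def] using ((ENNReal.continuous_pow 2).tendsto 0).comp h'
  · refine hvg.congr fun k => ?_
    exact gagliardo_congr_ae (v := v k - u) (hae.mono fun x hx => by simp [hx])
end
end

section
/- There exists a constant C > 0, independent of R, u, T and x₀, such that the following holds. For every T > 0, every C^∞ map u : [0,T]×S¹ → ℝ, every 0 < R < 1 and every x₀ ∈ S¹, writing v(t,·) := (−Δ)^{1/4}u(t,·) and w(t,·) := (−Δ)^{1/2}u(t,·): ∫₀^T ∫_{B_{3R/4}(x₀)} |v(t,x)|⁴ dx dt ≤ C · ( sup_{0≤t≤T} ∫_{B_R(x₀)} |v(t,x)|² dx ) · ( ∫₀^T ∫_{B_R(x₀)} |w(t,x)|² dx dt + R^{−2} ∫₀^T ∫_{S¹} |v(t,x)|² dx dt ). -/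
open MeasureTheory Real Filter
open scoped BigOperators ENNReal Real Topology

noncomputable section

/-! ### Convolution inequalities for nonnegative sequences -/

lemma ennreal_tsum_mul_sq_le {ι : Type*} (f g : ι → ℝ≥0∞) :
    (∑' i, f i * g i) ^ 2 ≤ (∑' i, f i ^ 2) * ∑' i, g i ^ 2 := by
  let _ : MeasurableSpace ι := ⊤
  have h := ENNReal.lintegral_mul_le_Lp_mul_Lq (Measure.count : Measure ι)
    Real.HolderConjugate.two_two (f := f) (g := g)
    measurable_from_top.aemeasurable measurable_from_top.aemeasurable
  simp only [lintegral_count, Pi.mul_apply, ENNReal.rpow_two] at h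
  calc (∑' i, f i * g i) ^ 2
      ≤ ((∑' i, f i ^ 2) ^ (1 / 2 : ℝ) * (∑' i, g i ^ 2) ^ (1 / 2 : ℝ)) ^ 2 := by gcongr
    _ = _ := by
      rw [mul_pow, ← ENNReal.rpow_two, ← ENNReal.rpow_two, ← ENNReal.rpow_mul, ← ENNReal.rpow_mul]
      norm_num

lemma ennreal_tsum_conv (f g : ℤ → ℝ≥0∞) :
    ∑' n, ∑' k, f k * g (n - k) = (∑' k, f k) * ∑' k, g k := by
  rw [ENNReal.tsum_comm, ← ENNReal.tsum_mul_right]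
  refine tsum_congr fun k => ?_
  rw [ENNReal.tsum_mul_left]
  congr 1
  exact (Equiv.subRight k).tsum_eq g

lemma ennreal_young_one_two (f g : ℤ → ℝ≥0∞) :
    ∑' n, (∑' k, f k * g (n - k)) ^ 2 ≤ (∑' k, f k) ^ 2 * ∑' k, g k ^ 2 := by
  have h : ∀ n, (∑' k, f k * g (n - k)) ^ 2 ≤
      (∑' k, f k) * ∑' k, f k * g (n - k) ^ 2 := by
    intro n
    have hs : ∀ x : ℝ≥0∞, (x ^ (1 / 2 : ℝ)) ^ 2 = x := fun x => by
      rw [← ENNReal.rpow_two, ← ENNReal.rpow_mul]; norm_num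
    have := ennreal_tsum_mul_sq_le (fun k => f k ^ (1 / 2 : ℝ))
      (fun k => f k ^ (1 / 2 : ℝ) * g (n - k))
    simp only [mul_pow, hs] at this
    simpa only [← mul_assoc, ← pow_two, hs] using this
  calc _ ≤ ∑' n, (∑' k, f k) * ∑' k, f k * g (n - k) ^ 2 := ENNReal.tsum_le_tsum h
    _ = _ := by
      rw [ENNReal.tsum_mul_left, ennreal_tsum_conv f (fun k => g k ^ 2), ← mul_assoc, pow_two]

lemma ennreal_tsum_conv_sq_le_weight (a w : ℤ → ℝ≥0∞) (hw0 : ∀ k, w k ≠ 0)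
    (hw : ∀ k, w k ≠ ⊤) :
    ∑' n, (∑' k, a k * a (n - k)) ^ 2 ≤ (∑' k, a k ^ 2 * w k) ^ 2 * ∑' k, (w k)⁻¹ ^ 2 := by
  have hs : ∀ x : ℝ≥0∞, (x ^ (1 / 2 : ℝ)) ^ 2 = x := fun x => by
    rw [← ENNReal.rpow_two, ← ENNReal.rpow_mul]; norm_num
  have hone : ∀ x : ℝ≥0∞, x ≠ 0 → x ≠ ⊤ → x ^ (1 / 2 : ℝ) * x⁻¹ ^ (1 / 2 : ℝ) = 1 := by
    intro x h0 h1
    rw [← ENNReal.mul_rpow_of_nonneg _ _ (by norm_num), ENNReal.mul_inv_cancel h0 h1,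
      ENNReal.one_rpow]
  have hW : ∀ n, ∑' k, (w k)⁻¹ * (w (n - k))⁻¹ ≤ ∑' k, (w k)⁻¹ ^ 2 := by
    intro n
    have h1 := ennreal_tsum_mul_sq_le (fun k => (w k)⁻¹) (fun k => (w (n - k))⁻¹)
    have h2 : ∑' k, (w (n - k))⁻¹ ^ 2 = ∑' k, (w k)⁻¹ ^ 2 :=
      (Equiv.subLeft n).tsum_eq fun k => (w k)⁻¹ ^ 2
    rw [h2, ← pow_two] at h1
    exact (ENNReal.pow_le_pow_left_iff two_ne_zero).1 h1
  have h : ∀ n, (∑' k, a k * a (n - k)) ^ 2 ≤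
      (∑' k, (a k ^ 2 * w k) * (a (n - k) ^ 2 * w (n - k))) * ∑' k, (w k)⁻¹ ^ 2 := by
    intro n
    have := ennreal_tsum_mul_sq_le
      (fun k => (a k * w k ^ (1 / 2 : ℝ)) * (a (n - k) * w (n - k) ^ (1 / 2 : ℝ)))
      (fun k => (w k)⁻¹ ^ (1 / 2 : ℝ) * (w (n - k))⁻¹ ^ (1 / 2 : ℝ))
    simp only [mul_pow, hs] at this
    refine le_trans (le_of_eq ?_) (this.trans (mul_le_mul' le_rfl (hW n)))
    congr 1
    refine tsum_congr fun k => ?_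
    calc a k * a (n - k) = a k * a (n - k) * (w k ^ (1 / 2 : ℝ) * (w k)⁻¹ ^ (1 / 2 : ℝ)) *
          (w (n - k) ^ (1 / 2 : ℝ) * (w (n - k))⁻¹ ^ (1 / 2 : ℝ)) := by
          rw [hone _ (hw0 _) (hw _), hone _ (hw0 _) (hw _), mul_one, mul_one]
      _ = _ := by ring
  calc _ ≤ ∑' n, (∑' k, (a k ^ 2 * w k) * (a (n - k) ^ 2 * w (n - k))) * ∑' k, (w k)⁻¹ ^ 2 :=
        ENNReal.tsum_le_tsum h
    _ = _ := by
      rw [ENNReal.tsum_mul_right,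
        ennreal_tsum_conv (fun k => a k ^ 2 * w k) (fun k => a k ^ 2 * w k), pow_two]

lemma ennreal_tsum_inv_add_natAbs_sq_le {N : ℝ} (hN : 1 ≤ N) :
    ∑' k : ℤ, (ENNReal.ofReal (N + k.natAbs))⁻¹ ^ 2 ≤ ENNReal.ofReal (3 / N) := by
  have hN0 : 0 < N := by linarith
  have hterm : ∀ m : ℕ, (ENNReal.ofReal (N + m))⁻¹ ^ 2 = ENNReal.ofReal (1 / (N + m) ^ 2) := by
    intro m
    have : 0 < N + m := by positivity
    rw [← ENNReal.ofReal_inv_of_pos this, ← ENNReal.ofReal_pow (by positivity)]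
    congr 1
    field_simp
  have hpos : ∀ M : ℕ, ∑ m ∈ Finset.range M, 1 / (N + (m + 1 : ℕ)) ^ 2 ≤ 1 / N - 1 / (N + M) := by
    intro M
    induction M with
    | zero => simp
    | succ M ih =>
      rw [Finset.sum_range_succ]
      have h1 : 0 < N + M := by positivity
      have : 1 / (N + (M + 1 : ℕ)) ^ 2 ≤ 1 / (N + M) - 1 / (N + (M + 1 : ℕ)) := by
        push_cast
        rw [div_sub_div _ _ (by positivity) (by positivity), div_le_div_iff₀ (by positivity)
          (by positivity)]
        nlinarith
      linarith
  have htail : ∑' m : ℕ, (ENNReal.ofReal (N + (m + 1 : ℕ)))⁻¹ ^ 2 ≤ ENNReal.ofReal (1 / N) := by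
    rw [ENNReal.tsum_eq_iSup_nat]
    refine iSup_le fun M => ?_
    simp_rw [hterm]
    rw [← ENNReal.ofReal_sum_of_nonneg (fun _ _ => by positivity)]
    refine ENNReal.ofReal_le_ofReal ((hpos M).trans ?_)
    have : 0 ≤ 1 / (N + M) := by positivity
    linarith
  have hzero : (ENNReal.ofReal (N + (0 : ℕ)))⁻¹ ^ 2 ≤ ENNReal.ofReal (1 / N) := by
    rw [hterm]
    refine ENNReal.ofReal_le_ofReal ?_
    simp only [Nat.cast_zero, add_zero]
    exact one_div_le_one_div_of_le hN0 (by nlinarith)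
  have hsplit : ∑' k : ℤ, (ENNReal.ofReal (N + k.natAbs))⁻¹ ^ 2 =
      ((ENNReal.ofReal (N + (0 : ℕ)))⁻¹ ^ 2 +
        ∑' m : ℕ, (ENNReal.ofReal (N + (m + 1 : ℕ)))⁻¹ ^ 2) +
        ∑' m : ℕ, (ENNReal.ofReal (N + (m + 1 : ℕ)))⁻¹ ^ 2 := by
    rw [tsum_of_nat_of_neg_add_one ENNReal.summable ENNReal.summable]
    congr 1
    rw [tsum_eq_zero_add' ENNReal.summable]
    rfl
  rw [hsplit]
  calc _ ≤ (ENNReal.ofReal (1 / N) + ENNReal.ofReal (1 / N)) + ENNReal.ofReal (1 / N) := by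
        gcongr
    _ = ENNReal.ofReal (3 / N) := by
      rw [← ENNReal.ofReal_add (by positivity) (by positivity),
        ← ENNReal.ofReal_add (by positivity) (by positivity)]
      congr 1
      ring

/-- The sequence form of the interpolation inequality `‖f‖_{L⁴}⁴ ≲ ‖f‖_{L²}² ‖f‖_{H^{1/2}}²`. -/
lemma ennreal_tsum_conv_sq_le_interp (a : ℤ → ℝ≥0∞) :
    ∑' n, (∑' k, a k * a (n - k)) ^ 2 ≤
      12 * (∑' k, a k ^ 2) * ∑' k : ℤ, (1 + (k.natAbs : ℝ≥0∞)) * a k ^ 2 := by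
  set A := ∑' k, a k ^ 2 with hA
  set B := ∑' k : ℤ, (1 + (k.natAbs : ℝ≥0∞)) * a k ^ 2 with hB
  have hAB : A ≤ B := by
    refine ENNReal.tsum_le_tsum fun k => ?_
    calc a k ^ 2 = 1 * a k ^ 2 := (one_mul _).symm
      _ ≤ _ := by gcongr; exact le_self_add
  rcases eq_or_ne A 0 with h0 | h0
  · have : ∀ k, a k = 0 := by
      intro k
      have := (ENNReal.tsum_eq_zero.1 h0) k
      simpa using this
    simp [this]
  rcases eq_or_ne B ⊤ with h1 | h1
  · rw [h1, ENNReal.mul_top (by simp [h0])]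
    exact le_top
  have hAt : A ≠ ⊤ := ne_top_of_le_ne_top h1 hAB
  have hAr : 0 < A.toReal := ENNReal.toReal_pos h0 hAt
  have hABr : A.toReal ≤ B.toReal := ENNReal.toReal_mono h1 hAB
  set N : ℝ := B.toReal / A.toReal with hN
  have hN1 : 1 ≤ N := by rw [hN, le_div_iff₀ hAr]; linarith
  have hN0 : 0 < N := by linarith
  have hNe : ENNReal.ofReal N * A = B := by
    conv_lhs => rw [← ENNReal.ofReal_toReal hAt]
    rw [← ENNReal.ofReal_mul hN0.le, hN, div_mul_cancel₀ _ hAr.ne', ENNReal.ofReal_toReal h1]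
  have hw := ennreal_tsum_conv_sq_le_weight a (fun k => ENNReal.ofReal (N + k.natAbs))
    (fun k => by
      have : 0 < N + k.natAbs := by positivity
      simpa using this) (fun k => ENNReal.ofReal_ne_top)
  have hsum : ∑' k : ℤ, a k ^ 2 * ENNReal.ofReal (N + k.natAbs) ≤ 2 * B := by
    calc ∑' k : ℤ, a k ^ 2 * ENNReal.ofReal (N + k.natAbs)
        ≤ ∑' k : ℤ, (ENNReal.ofReal N * a k ^ 2 + (1 + (k.natAbs : ℝ≥0∞)) * a k ^ 2) := by
          refine ENNReal.tsum_le_tsum fun k => ?_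
          rw [ENNReal.ofReal_add hN0.le (by positivity), ENNReal.ofReal_natCast, mul_add,
            mul_comm, mul_comm (a k ^ 2)]
          gcongr
          exact le_add_self
      _ = 2 * B := by
          rw [ENNReal.tsum_add, ENNReal.tsum_mul_left, ← hA, ← hB, hNe, two_mul]
  calc _ ≤ _ := hw
    _ ≤ (2 * B) ^ 2 * ENNReal.ofReal (3 / N) := by
      gcongr
      exact ennreal_tsum_inv_add_natAbs_sq_le hN1
    _ = 12 * A * B := by
      rw [← ENNReal.ofReal_toReal hAt, ← ENNReal.ofReal_toReal h1,
        show (2 : ℝ≥0∞) = ENNReal.ofReal 2 by simp, show (12 : ℝ≥0∞) = ENNReal.ofReal 12 by simp,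
        ← ENNReal.ofReal_mul (by norm_num), ← ENNReal.ofReal_pow (by positivity),
        ← ENNReal.ofReal_mul (by positivity), ← ENNReal.ofReal_mul (by positivity),
        ← ENNReal.ofReal_mul (by positivity)]
      congr 1
      have hBr : 0 < B.toReal := by linarith
      rw [hN]
      field_simp
      ring

/-! ### Absolutely convergent Fourier series -/

/-- The Fourier series with coefficients `c`. -/
def fourierSum (c : ℤ → ℂ) (x : ℝ) : ℂ :=
  ∑' k : ℤ, c k * Complex.exp (Complex.I * (k : ℂ) * (x : ℂ))

/-- The convolution of two sequences indexed by `ℤ`. -/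
def seqConv (c d : ℤ → ℂ) (n : ℤ) : ℂ := ∑' k : ℤ, c k * d (n - k)

lemma norm_cexp_I_mul (k : ℤ) (x : ℝ) :
    ‖Complex.exp (Complex.I * (k : ℂ) * (x : ℂ))‖ = 1 := by
  rw [Complex.norm_exp]; simp

lemma norm_fourierSum_term (c : ℤ → ℂ) (k : ℤ) (x : ℝ) :
    ‖c k * Complex.exp (Complex.I * (k : ℂ) * (x : ℂ))‖ = ‖c k‖ := by
  rw [norm_mul, norm_cexp_I_mul, mul_one]

lemma summable_fourierSum {c : ℤ → ℂ} (hc : Summable fun k => ‖c k‖) (x : ℝ) :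
    Summable fun k : ℤ => ‖c k * Complex.exp (Complex.I * (k : ℂ) * (x : ℂ))‖ := by
  simpa only [norm_fourierSum_term] using hc

lemma continuous_fourierSum {c : ℤ → ℂ} (hc : Summable fun k => ‖c k‖) :
    Continuous (fourierSum c) :=
  continuous_tsum (fun k => by fun_prop) hc fun k x => (norm_fourierSum_term c k x).le

/-- The shear `(n, k) ↦ (k, n - k)` of `ℤ × ℤ`. -/
def convEquiv : ℤ × ℤ ≃ ℤ × ℤ where
  toFun p := (p.2, p.1 - p.2)
  invFun p := (p.1 + p.2, p.1)
  left_inv p := by simp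
  right_inv p := by simp

lemma summable_conv_prod {c d : ℤ → ℂ} (hc : Summable fun k => ‖c k‖)
    (hd : Summable fun k => ‖d k‖) :
    Summable fun p : ℤ × ℤ => ‖c p.2 * d (p.1 - p.2)‖ := by
  have h := hc.mul_norm hd
  exact (convEquiv.summable_iff (f := fun p : ℤ × ℤ => ‖c p.1 * d p.2‖)).2 h

lemma summable_seqConv {c d : ℤ → ℂ} (hc : Summable fun k => ‖c k‖)
    (hd : Summable fun k => ‖d k‖) : Summable fun n => ‖seqConv c d n‖ := by
  have h := summable_conv_prod hc hd
  have h2 := (summable_prod_of_nonneg (fun _ => norm_nonneg _)).1 h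
  exact Summable.of_nonneg_of_le (fun _ => norm_nonneg _)
    (fun n => norm_tsum_le_tsum_norm (h2.1 n)) h2.2

lemma enorm_seqConv_le (c d : ℤ → ℂ) (n : ℤ) :
    ‖seqConv c d n‖ₑ ≤ ∑' k, ‖c k‖ₑ * ‖d (n - k)‖ₑ := by
  simp_rw [← enorm_mul]
  exact enorm_tsum_le_tsum_enorm

lemma fourierSum_seqConv {c d : ℤ → ℂ} (hc : Summable fun k => ‖c k‖)
    (hd : Summable fun k => ‖d k‖) (x : ℝ) :
    fourierSum (seqConv c d) x = fourierSum c x * fourierSum d x := by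
  have hcx := summable_fourierSum hc x
  have hdx := summable_fourierSum hd x
  have hterm : ∀ p : ℤ × ℤ,
      c p.2 * d (p.1 - p.2) * Complex.exp (Complex.I * (p.1 : ℂ) * (x : ℂ)) =
        (c p.2 * Complex.exp (Complex.I * (p.2 : ℂ) * (x : ℂ))) *
          (d (p.1 - p.2) * Complex.exp (Complex.I * ((p.1 - p.2 : ℤ) : ℂ) * (x : ℂ))) := by
    intro p
    rw [mul_mul_mul_comm, ← Complex.exp_add]
    congr 2
    push_cast
    ring
  have hsum : Summable fun p : ℤ × ℤ =>
      c p.2 * d (p.1 - p.2) * Complex.exp (Complex.I * (p.1 : ℂ) * (x : ℂ)) := by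
    refine Summable.of_norm ?_
    simp_rw [norm_mul _ (Complex.exp _), norm_cexp_I_mul, mul_one]
    exact summable_conv_prod hc hd
  rw [fourierSum, fourierSum, fourierSum, tsum_mul_tsum_of_summable_norm hcx hdx,
    ← convEquiv.tsum_eq]
  calc _ = ∑' n : ℤ, ∑' k : ℤ,
        c k * d (n - k) * Complex.exp (Complex.I * (n : ℂ) * (x : ℂ)) := by
        refine tsum_congr fun n => ?_
        rw [seqConv, tsum_mul_right]
    _ = ∑' p : ℤ × ℤ,
        c p.2 * d (p.1 - p.2) * Complex.exp (Complex.I * (p.1 : ℂ) * (x : ℂ)) :=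
        (hsum.tsum_prod).symm
    _ = _ := tsum_congr fun p => hterm p

lemma integral_cexp_I_mul (k : ℤ) (a : ℝ) :
    ∫ x in a..a + 2 * π, Complex.exp (Complex.I * (k : ℂ) * (x : ℂ)) =
      if k = 0 then ((2 * π : ℝ) : ℂ) else 0 := by
  split_ifs with hk
  · simp [hk]
  · have hne : Complex.I * (k : ℂ) ≠ 0 := by simp [hk]
    rw [integral_exp_mul_complex hne]
    have : Complex.exp (Complex.I * k * ((a + 2 * π : ℝ) : ℂ)) =
        Complex.exp (Complex.I * k * (a : ℂ)) := by
      rw [show Complex.I * k * ((a + 2 * π : ℝ) : ℂ) =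
        Complex.I * k * (a : ℂ) + k * (2 * π * Complex.I) by push_cast; ring,
        Complex.exp_add, Complex.exp_int_mul_two_pi_mul_I, mul_one]
    rw [this, sub_self, zero_div]

lemma integral_fourierSum {c : ℤ → ℂ} (hc : Summable fun k => ‖c k‖) (a : ℝ) :
    ∫ x in a..a + 2 * π, fourierSum c x = ((2 * π : ℝ) : ℂ) * c 0 := by
  have hle : a ≤ a + 2 * π := by linarith [Real.pi_pos]
  have hvol : (volume.restrict (Set.Ioc a (a + 2 * π))).real Set.univ = 2 * π := by
    simp [Measure.real, Real.pi_pos.le]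
  have h := hasSum_integral_of_summable_integral_norm
    (μ := volume.restrict (Set.Ioc a (a + 2 * π)))
    (F := fun (k : ℤ) (x : ℝ) => c k * Complex.exp (Complex.I * (k : ℂ) * (x : ℂ)))
    (fun k => by
      have : Continuous fun x : ℝ => c k * Complex.exp (Complex.I * (k : ℂ) * (x : ℂ)) := by
        fun_prop
      exact (this.integrableOn_Ioc))
    (by
      simp_rw [norm_fourierSum_term, integral_const, hvol, smul_eq_mul]
      exact hc.mul_left _)
  rw [intervalIntegral.integral_of_le hle]
  change ∫ x in Set.Ioc a (a + 2 * π),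
    ∑' k : ℤ, c k * Complex.exp (Complex.I * (k : ℂ) * (x : ℂ)) = _
  rw [← h.tsum_eq]
  simp_rw [← intervalIntegral.integral_of_le hle, intervalIntegral.integral_const_mul,
    integral_cexp_I_mul]
  rw [tsum_eq_single 0 (fun k hk => by simp [hk])]
  simp [mul_comm]

lemma conj_fourierSum (c : ℤ → ℂ) (x : ℝ) :
    (starRingEnd ℂ) (fourierSum c x) =
      fourierSum (fun k => (starRingEnd ℂ) (c (-k))) x := by
  rw [fourierSum, fourierSum, Complex.conj_tsum, ← (Equiv.neg ℤ).tsum_eq]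
  refine tsum_congr fun k => ?_
  simp [← Complex.exp_conj]

/-- Parseval's identity for an absolutely convergent Fourier series, over any period. -/
lemma lintegral_enorm_fourierSum_sq {c : ℤ → ℂ} (hc : Summable fun k => ‖c k‖) (a : ℝ) :
    ∫⁻ x in Set.Ioc a (a + 2 * π), ‖fourierSum c x‖ₑ ^ 2 =
      ENNReal.ofReal (2 * π) * ∑' k, ‖c k‖ₑ ^ 2 := by
  set d : ℤ → ℂ := fun k => (starRingEnd ℂ) (c (-k)) with hd
  have hds : Summable fun k => ‖d k‖ := by
    simpa [hd, Function.comp_def] using (Equiv.neg ℤ).summable_iff.2 hc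
  have hle : a ≤ a + 2 * π := by linarith [Real.pi_pos]
  have hsq : Summable fun k => ‖c k‖ ^ 2 := by
    refine hc.of_norm_bounded_eventually (g := fun k => ‖c k‖) ?_
    filter_upwards [hc.tendsto_cofinite_zero.eventually (gt_mem_nhds one_pos)] with k hk
    rw [Real.norm_of_nonneg (by positivity)]
    nlinarith [norm_nonneg (c k)]
  have hx : ∀ x, ((‖fourierSum c x‖ ^ 2 : ℝ) : ℂ) = fourierSum (seqConv c d) x := by
    intro x
    rw [fourierSum_seqConv hc hds, ← conj_fourierSum, Complex.mul_conj, Complex.normSq_eq_norm_sq]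
  have h0 : seqConv c d 0 = ((∑' k, ‖c k‖ ^ 2 : ℝ) : ℂ) := by
    rw [seqConv, Complex.ofReal_tsum]
    refine tsum_congr fun k => ?_
    simp [hd, Complex.mul_conj, Complex.normSq_eq_norm_sq]
  have hint : ∫ x in Set.Ioc a (a + 2 * π), ‖fourierSum c x‖ ^ 2 =
      2 * π * ∑' k, ‖c k‖ ^ 2 := by
    have h := integral_fourierSum (summable_seqConv hc hds) a
    simp_rw [← hx] at h
    rw [intervalIntegral.integral_ofReal, h0, ← Complex.ofReal_mul,
      intervalIntegral.integral_of_le hle] at h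
    exact_mod_cast h
  have hcont : Continuous fun x => ‖fourierSum c x‖ ^ 2 := (continuous_fourierSum hc).norm.pow 2
  have hen : ∀ z : ℂ, ‖z‖ₑ ^ 2 = ENNReal.ofReal (‖z‖ ^ 2) := fun z => by
    rw [← ofReal_norm, ENNReal.ofReal_pow (norm_nonneg _)]
  simp_rw [hen]
  rw [← ofReal_integral_eq_lintegral_ofReal hcont.integrableOn_Ioc
    (Filter.Eventually.of_forall fun x => by positivity), hint,
    ENNReal.ofReal_mul (by positivity), ENNReal.ofReal_tsum_of_nonneg (fun _ => by positivity) hsq]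

/-! ### Fourier coefficients -/

lemma setIntegral_circ {F : Type*} [NormedAddCommGroup F] [NormedSpace ℝ F] (g : ℝ → F) :
    ∫ x in circ, g x = ∫ x in (-π)..(-π + 2 * π), g x := by
  rw [intervalIntegral.integral_of_le (by linarith [Real.pi_pos]), circ,
    show -π + 2 * π = π by ring]

lemma setIntegral_circ_eq_of_periodic {F : Type*} [NormedAddCommGroup F] [NormedSpace ℝ F]
    {g : ℝ → F} (hg : Function.Periodic g (2 * π)) (a : ℝ) :
    ∫ x in circ, g x = ∫ x in a..a + 2 * π, g x := by
  rw [setIntegral_circ, hg.intervalIntegral_add_eq]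

lemma periodic_cexp_neg_I_mul (k : ℤ) :
    Function.Periodic (fun x : ℝ => Complex.exp (-(Complex.I * (k : ℂ) * (x : ℂ)))) (2 * π) := by
  intro x
  change Complex.exp (-(Complex.I * k * ((x + 2 * π : ℝ) : ℂ))) = _
  rw [show -(Complex.I * k * ((x + 2 * π : ℝ) : ℂ)) =
    -(Complex.I * k * (x : ℂ)) + (-k : ℤ) * (2 * π * Complex.I) by push_cast; ring,
    Complex.exp_add, Complex.exp_int_mul_two_pi_mul_I, mul_one]

lemma norm_cexp_neg_I_mul (k : ℤ) (x : ℝ) :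
    ‖Complex.exp (-(Complex.I * (k : ℂ) * (x : ℂ)))‖ = 1 := by
  rw [Complex.norm_exp]; simp

lemma fc_of_hasDerivAt {f f' : ℝ → ℂ} (hf : ∀ x, HasDerivAt f (f' x) x) (hf' : Continuous f')
    (hp : Function.Periodic f (2 * π)) (k : ℤ) : fc f' k = Complex.I * k * fc f k := by
  have he : ∀ x : ℝ, HasDerivAt (fun x : ℝ => Complex.exp (-(Complex.I * (k : ℂ) * (x : ℂ))))
      (-(Complex.I * k) * Complex.exp (-(Complex.I * (k : ℂ) * (x : ℂ)))) x := by
    intro x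
    have h1 : HasDerivAt (fun x : ℝ => -(Complex.I * (k : ℂ) * (x : ℂ))) (-(Complex.I * k)) x := by
      simpa using (Complex.ofRealCLM.hasDerivAt (x := x)).const_mul (-(Complex.I * (k : ℂ)))
    simpa [mul_comm] using h1.cexp
  have h := intervalIntegral.integral_mul_deriv_eq_deriv_mul (a := -π) (b := -π + 2 * π)
    (fun x _ => he x) (fun x _ => hf x)
    (Continuous.intervalIntegrable (by fun_prop) _ _) (hf'.intervalIntegrable _ _)
  have hb := periodic_cexp_neg_I_mul k (-π)
  beta_reduce at hb
  rw [hp, hb, sub_self, zero_sub] at h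
  rw [fc, fc, setIntegral_circ, setIntegral_circ]
  simp_rw [mul_comm (f' _), mul_comm (f _), h, mul_assoc, neg_mul, intervalIntegral.integral_neg,
    mul_assoc, intervalIntegral.integral_const_mul]
  ring

lemma norm_fc_le (f : ℝ → ℂ) (k : ℤ) : ‖fc f k‖ ≤ 1 / (2 * π) * ∫ x in circ, ‖f x‖ := by
  rw [fc, norm_mul, Complex.norm_real, Real.norm_of_nonneg (by positivity)]
  gcongr
  refine (norm_integral_le_integral_norm _).trans (le_of_eq ?_)
  simp_rw [norm_mul, norm_cexp_neg_I_mul, mul_one]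

lemma norm_fc_mul_sq_le {f f' f'' : ℝ → ℂ} (hf : ∀ x, HasDerivAt f (f' x) x)
    (hf' : ∀ x, HasDerivAt f' (f'' x) x) (hf'' : Continuous f'')
    (hp : Function.Periodic f (2 * π)) (hp' : Function.Periodic f' (2 * π)) (k : ℤ) :
    (k : ℝ) ^ 2 * ‖fc f k‖ ≤ 1 / (2 * π) * ∫ x in circ, ‖f'' x‖ := by
  have hc' : Continuous f' := continuous_iff_continuousAt.2 fun x => (hf' x).continuousAt
  have h := norm_fc_le f'' k
  rw [fc_of_hasDerivAt hf' hf'' hp', fc_of_hasDerivAt hf hc' hp] at h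
  simpa [norm_mul, ← mul_assoc, ← pow_two] using h

lemma fourierSum_fc {f : ℝ → ℂ} (hf : Continuous f) (hp : Function.Periodic f (2 * π))
    (hs : Summable fun k => ‖fc f k‖) (x : ℝ) : fourierSum (fc f) x = f x := by
  have : Fact (0 < 2 * π) := ⟨Real.two_pi_pos⟩
  let g : C(AddCircle (2 * π), ℂ) := ⟨hp.lift, continuous_coinduced_dom.mpr hf⟩
  have hg : ∀ y : ℝ, g (y : AddCircle (2 * π)) = f y := fun y => hp.lift_coe y
  have hfour : ∀ (k : ℤ) (y : ℝ), fourier k (y : AddCircle (2 * π)) =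
      Complex.exp (Complex.I * (k : ℂ) * (y : ℂ)) := by
    intro k y
    rw [fourier_coe_apply]
    congr 1
    have : (π : ℂ) ≠ 0 := by exact_mod_cast Real.pi_ne_zero
    push_cast
    field_simp
  have hco : ∀ k, fourierCoeff g k = fc f k := by
    intro k
    rw [fourierCoeff_eq_intervalIntegral _ _ (-π), fc, setIntegral_circ, Complex.real_smul]
    congr 1
    refine intervalIntegral.integral_congr fun y _ => ?_
    simp only [hg, hfour, smul_eq_mul]
    rw [mul_comm]
    congr 2
    push_cast
    ring
  have h := has_pointwise_sum_fourier_series_of_summable (f := g)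
    (by simp_rw [show fourierCoeff (⇑g) = fc f from funext hco]; exact hs.of_norm)
    (x : AddCircle (2 * π))
  simp only [hco, hfour, hg, smul_eq_mul] at h
  exact h.tsum_eq

lemma conj_fc_ofReal (f : ℝ → ℝ) (k : ℤ) :
    (starRingEnd ℂ) (fc (fun x => (f x : ℂ)) (-k)) = fc (fun x => (f x : ℂ)) k := by
  rw [fc, fc, map_mul, Complex.conj_ofReal, ← integral_conj]
  congr 2
  ext x
  simp [← Complex.exp_conj]

/-! ### Cutoff functions -/

lemma exists_smooth_step : ∃ (h h' h'' : ℝ → ℝ) (M : ℝ), 0 ≤ M ∧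
    (∀ s, HasDerivAt h (h' s) s) ∧ (∀ s, HasDerivAt h' (h'' s) s) ∧ Continuous h'' ∧
    (∀ s, |h' s| ≤ M) ∧ (∀ s, |h'' s| ≤ M) ∧ (∀ s, 0 ≤ h s) ∧ (∀ s, h s ≤ 1) ∧
    (∀ s ≤ 9 / 32, h s = 1) ∧ (∀ s > 2 / 5, h s = 0) ∧ (∀ s > 2 / 5, h' s = 0) ∧
    (∀ s > 2 / 5, h'' s = 0) := by
  set h : ℝ → ℝ := fun s => Real.smoothTransition ((2 / 5 - s) / (19 / 160)) with hh
  have hsm : ContDiff ℝ 2 h := by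
    have : ContDiff ℝ 2 Real.smoothTransition := Real.smoothTransition.contDiff (n := 2)
    exact this.comp (by fun_prop)
  have hd : ContDiff ℝ 1 (deriv h) := by
    have := (contDiff_succ_iff_deriv (n := 1)).1 (by rw [one_add_one_eq_two]; exact hsm)
    exact this.2.2
  have hdd : Continuous (deriv (deriv h)) := hd.continuous_deriv le_rfl
  have hone : ∀ s ≤ 9 / 32, h s = 1 := fun s hs =>
    Real.smoothTransition.one_of_one_le (by rw [le_div_iff₀ (by norm_num)]; linarith)
  have hzero : ∀ s > 2 / 5, h s = 0 := fun s hs =>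
    Real.smoothTransition.zero_of_nonpos (div_nonpos_of_nonpos_of_nonneg (by linarith)
      (by norm_num))
  have hz : ∀ s > 2 / 5, h =ᶠ[𝓝 s] fun _ => 0 := fun s hs => by
    filter_upwards [lt_mem_nhds hs] with y hy using hzero y hy
  have hz' : ∀ s > 2 / 5, deriv h s = 0 := fun s hs => by
    rw [(hz s hs).deriv_eq]; simp
  have hz'' : ∀ s > 2 / 5, deriv (deriv h) s = 0 := fun s hs => by
    rw [(hz s hs).deriv.deriv_eq]; simp
  have hlow : ∀ s < 9 / 32, deriv h s = 0 := fun s hs => by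
    have : h =ᶠ[𝓝 s] fun _ => 1 := by
      filter_upwards [gt_mem_nhds hs] with y hy using hone y hy.le
    rw [this.deriv_eq]; simp
  have hcs : HasCompactSupport (deriv h) := by
    refine HasCompactSupport.intro (isCompact_Icc (a := (9 / 32 : ℝ)) (b := 2 / 5)) fun s hs => ?_
    rcases lt_or_ge s (9 / 32) with h1 | h1
    · exact hlow s h1
    · exact hz' s (not_le.1 fun h2 => hs ⟨h1, h2⟩)
  obtain ⟨M₁, hM₁⟩ := hd.continuous.bounded_above_of_compact_support hcs
  obtain ⟨M₂, hM₂⟩ := hdd.bounded_above_of_compact_support hcs.deriv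
  have hM₁0 : 0 ≤ M₁ := (norm_nonneg _).trans (hM₁ 0)
  refine ⟨h, deriv h, deriv (deriv h), max M₁ M₂, hM₁0.trans (le_max_left _ _),
    fun s => ((hsm.differentiable (by norm_num)) s).hasDerivAt,
    fun s => ((hd.differentiable (by norm_num)) s).hasDerivAt, hdd,
    fun s => (hM₁ s).trans (le_max_left _ _), fun s => (hM₂ s).trans (le_max_right _ _),
    fun s => Real.smoothTransition.nonneg _, fun s => Real.smoothTransition.le_one _,
    hone, hzero, hz', hz''⟩

lemma mul_sq_lt_one_sub_cos {R y : ℝ} (hR : 0 < R) (hR1 : R < 1) (hy : R ≤ |y|) (hyπ : |y| ≤ π) :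
    2 / 5 < (1 - Real.cos y) / R ^ 2 := by
  have h1 : Real.cos |y| ≤ Real.cos R := Real.cos_le_cos_of_nonneg_of_le_pi hR.le hyπ hy
  rw [Real.cos_abs] at h1
  have h2 := (abs_le.1 (Real.cos_bound (x := R) (by rw [abs_of_pos hR]; exact hR1.le))).2
  rw [abs_of_pos hR] at h2
  rw [lt_div_iff₀ (by positivity)]
  have h3 : R ^ 4 ≤ R ^ 2 := pow_le_pow_of_le_one hR.le hR1.le (by norm_num)
  have h4 : 0 < R ^ 2 := by positivity
  linarith

/-- Cutoff functions on the circle, with the scale-invariant decay of their Fourier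
coefficients. -/
lemma exists_cutoff : ∃ K : ℝ, 0 ≤ K ∧ ∀ R : ℝ, 0 < R → R < 1 → ∀ x₀ : ℝ, ∃ φ : ℝ → ℝ,
    Continuous φ ∧ Function.Periodic φ (2 * π) ∧ (∀ x, 0 ≤ φ x) ∧ (∀ x, φ x ≤ 1) ∧
    (∀ x ∈ Set.Ioo (x₀ - 3 * R / 4) (x₀ + 3 * R / 4), φ x = 1) ∧
    (∀ x ∈ Set.Ioc (x₀ - π) (x₀ - π + 2 * π) \ Set.Ioo (x₀ - R) (x₀ + R), φ x = 0) ∧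
    ∀ k : ℤ, (k : ℝ) ^ 2 * ‖fc (fun x => (φ x : ℂ)) k‖ ≤ K / R := by
  obtain ⟨h, h', h'', M, hM, hd, hd', hc'', hb', hb'', h0, h1, hone, hz, hz', hz''⟩ :=
    exists_smooth_step
  refine ⟨M, hM, fun R hR hR1 x₀ => ?_⟩
  set s : ℝ → ℝ := fun x => (1 - Real.cos (x - x₀)) / R ^ 2 with hs
  have hsd : ∀ x, HasDerivAt s (Real.sin (x - x₀) / R ^ 2) x := by
    intro x
    have := ((((hasDerivAt_id x).sub_const x₀).cos).const_sub 1).div_const (R ^ 2)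
    simpa using this
  have hsind : ∀ x, HasDerivAt (fun x => Real.sin (x - x₀) / R ^ 2)
      (Real.cos (x - x₀) / R ^ 2) x := by
    intro x
    have := (((hasDerivAt_id x).sub_const x₀).sin).div_const (R ^ 2)
    simpa using this
  have hcos : ∀ x, Real.cos (x + 2 * π - x₀) = Real.cos (x - x₀) := fun x => by
    rw [show x + 2 * π - x₀ = x - x₀ + 2 * π by ring, Real.cos_add_two_pi]
  have hsin : ∀ x, Real.sin (x + 2 * π - x₀) = Real.sin (x - x₀) := fun x => by
    rw [show x + 2 * π - x₀ = x - x₀ + 2 * π by ring, Real.sin_add_two_pi]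
  set φ' : ℝ → ℝ := fun x => h' (s x) * (Real.sin (x - x₀) / R ^ 2) with hφ'
  set φ'' : ℝ → ℝ := fun x => h'' (s x) * (Real.sin (x - x₀) / R ^ 2) *
    (Real.sin (x - x₀) / R ^ 2) + h' (s x) * (Real.cos (x - x₀) / R ^ 2) with hφ''
  have hφd : ∀ x, HasDerivAt (fun x => h (s x)) (φ' x) x := fun x => (hd (s x)).comp x (hsd x)
  have hφd' : ∀ x, HasDerivAt φ' (φ'' x) x := fun x =>
    ((hd' (s x)).comp x (hsd x)).mul (hsind x)
  have hsc : Continuous s := by fun_prop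
  have hh'c : Continuous h' := continuous_iff_continuousAt.2 fun x => (hd' x).continuousAt
  have hφ''c : Continuous φ'' := by fun_prop
  have hfar : ∀ x ∈ Set.Ioc (x₀ - π) (x₀ - π + 2 * π) \ Set.Ioo (x₀ - R) (x₀ + R),
      2 / 5 < s x := by
    rintro x ⟨⟨hx1, hx2⟩, hx3⟩
    refine mul_sq_lt_one_sub_cos hR hR1 ?_ (abs_le.2 ⟨by linarith, by linarith⟩)
    by_contra hlt
    rw [not_le, abs_lt] at hlt
    exact hx3 ⟨by linarith [hlt.1], by linarith [hlt.2]⟩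
  have hφp : Function.Periodic (fun x => h (s x)) (2 * π) := fun x => by
    simp only [hs, hcos]
  have hφp' : Function.Periodic φ' (2 * π) := fun x => by
    simp only [hφ', hs, hcos, hsin]
  have hφp'' : Function.Periodic φ'' (2 * π) := fun x => by
    simp only [hφ'', hs, hcos, hsin]
  refine ⟨fun x => h (s x), continuous_iff_continuousAt.2 fun x => (hφd x).continuousAt, hφp,
    fun x => h0 _, fun x => h1 _, ?_, fun x hx => hz _ (hfar x hx), fun k => ?_⟩
  · rintro x ⟨hx1, hx2⟩
    refine hone _ ?_
    rw [hs, div_le_iff₀ (by positivity)]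
    have := Real.one_sub_sq_div_two_le_cos (x := x - x₀)
    nlinarith
  · have hk := norm_fc_mul_sq_le (f := fun x => (h (s x) : ℂ)) (f' := fun x => (φ' x : ℂ))
      (f'' := fun x => (φ'' x : ℂ)) (fun x => (hφd x).ofReal_comp) (fun x => (hφd' x).ofReal_comp)
      (Complex.continuous_ofReal.comp hφ''c) (fun x => by simp only [hφp x])
      (fun x => by simp only [hφp' x]) k
    refine hk.trans ?_
    have hper : Function.Periodic (fun x => ‖(φ'' x : ℂ)‖) (2 * π) := fun x => by
      simp only [hφp'' x]
    have hsub : Set.Ioo (x₀ - R) (x₀ + R) ⊆ Set.Ioc (x₀ - π) (x₀ - π + 2 * π) := by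
      rintro x ⟨hx1, hx2⟩
      have := Real.pi_gt_three
      exact ⟨by linarith, by linarith⟩
    rw [setIntegral_circ_eq_of_periodic hper (x₀ - π),
      intervalIntegral.integral_of_le (by linarith [Real.pi_pos]),
      setIntegral_eq_of_subset_of_forall_sdiff_eq_zero measurableSet_Ioc hsub
        (fun x hx => by simp [hφ'', hz' _ (hfar x hx), hz'' _ (hfar x hx)])]
    have hbd : ∀ x ∈ Set.Ioo (x₀ - R) (x₀ + R), ‖(‖(φ'' x : ℂ)‖ : ℝ)‖ ≤ 2 * M / R ^ 2 := by
      rintro x ⟨hx1, hx2⟩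
      rw [norm_norm, Complex.norm_real, Real.norm_eq_abs]
      have hsR : |Real.sin (x - x₀)| ≤ R :=
        Real.abs_sin_le_abs.trans (abs_le.2 ⟨by linarith, by linarith⟩)
      have hsR' : |Real.sin (x - x₀) / R ^ 2| ≤ 1 / R := by
        rw [abs_div, abs_of_pos (by positivity : 0 < R ^ 2), div_le_div_iff₀ (by positivity) hR]
        nlinarith
      have hcR : |Real.cos (x - x₀) / R ^ 2| ≤ 1 / R ^ 2 := by
        rw [abs_div, abs_of_pos (by positivity : 0 < R ^ 2)]
        gcongr
        exact Real.abs_cos_le_one _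
      calc |φ'' x| ≤ |h'' (s x)| * |Real.sin (x - x₀) / R ^ 2| * |Real.sin (x - x₀) / R ^ 2| +
            |h' (s x)| * |Real.cos (x - x₀) / R ^ 2| := by
            rw [← abs_mul, ← abs_mul, ← abs_mul]; exact abs_add_le _ _
        _ ≤ M * (1 / R) * (1 / R) + M * (1 / R ^ 2) := by
            gcongr
            · exact hb'' _
            · exact hb' _
        _ = 2 * M / R ^ 2 := by field_simp; ring
    have hint := norm_setIntegral_le_of_norm_le_const (μ := volume)
      (by simp : volume (Set.Ioo (x₀ - R) (x₀ + R)) < ⊤) hbd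
    have hvol : volume.real (Set.Ioo (x₀ - R) (x₀ + R)) = 2 * R := by
      rw [Real.volume_real_Ioo_of_le (by linarith)]; ring
    rw [hvol] at hint
    have hint2 := (le_abs_self _).trans hint
    calc 1 / (2 * π) * ∫ x in Set.Ioo (x₀ - R) (x₀ + R), ‖(φ'' x : ℂ)‖
        ≤ 1 / (2 * π) * (2 * M / R ^ 2 * (2 * R)) := by gcongr
      _ = (2 / π) * (M / R) := by field_simp
      _ ≤ 1 * (M / R) := by
          gcongr
          rw [div_le_one Real.pi_pos]
          linarith [Real.pi_gt_three]
      _ = M / R := one_mul _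

/-! ### The estimate at a fixed time -/

lemma abs_sqrt_natAbs_sub_le (n k : ℤ) :
    |√(n.natAbs : ℝ) - √((n - k).natAbs : ℝ)| ≤ √(k.natAbs : ℝ) := by
  have key : ∀ a b c : ℕ, a ≤ b + c → √(a : ℝ) - √(b : ℝ) ≤ √(c : ℝ) := by
    intro a b c h
    have h1 : (a : ℝ) ≤ b + c := by exact_mod_cast h
    have h2 : √(a : ℝ) ≤ √(b : ℝ) + √(c : ℝ) := by
      refine Real.sqrt_le_iff.2 ⟨by positivity, ?_⟩
      have h3 := Real.sq_sqrt (Nat.cast_nonneg (α := ℝ) b)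
      have h4 := Real.sq_sqrt (Nat.cast_nonneg (α := ℝ) c)
      have h5 : 0 ≤ √(b : ℝ) * √(c : ℝ) := by positivity
      nlinarith
    linarith
  rw [abs_sub_le_iff]
  exact ⟨key _ _ _ (by omega), key _ _ _ (by omega)⟩

lemma natAbs_mul_enorm_seqConv_sq_le {p q r : ℤ → ℂ} (hp : Summable fun k => ‖p k‖)
    (hq : Summable fun k => ‖q k‖) (hr : Summable fun k => ‖r k‖)
    (hqr : ∀ k, r k = ((√(k.natAbs : ℝ) : ℝ) : ℂ) * q k) (n : ℤ) :
    (n.natAbs : ℝ≥0∞) * ‖seqConv p q n‖ₑ ^ 2 ≤ 2 * ‖seqConv p r n‖ₑ ^ 2 +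
      2 * (∑' k, ENNReal.ofReal √(k.natAbs : ℝ) * ‖p k‖ₑ * ‖q (n - k)‖ₑ) ^ 2 := by
  have hq' : Summable fun k => p k * q (n - k) :=
    .of_norm ((summable_conv_prod hp hq).prod_factor n)
  have hr' : Summable fun k => p k * r (n - k) :=
    .of_norm ((summable_conv_prod hp hr).prod_factor n)
  set X := ∑' k, ENNReal.ofReal √(k.natAbs : ℝ) * ‖p k‖ₑ * ‖q (n - k)‖ₑ with hX
  have hsplit : ((√(n.natAbs : ℝ) : ℝ) : ℂ) * seqConv p q n = seqConv p r n +
      ∑' k, (((√(n.natAbs : ℝ) : ℝ) : ℂ) * (p k * q (n - k)) - p k * r (n - k)) := by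
    rw [(hq'.mul_left _).tsum_sub hr', tsum_mul_left]
    simp only [seqConv]
    ring
  have hrem : ‖∑' k, (((√(n.natAbs : ℝ) : ℝ) : ℂ) * (p k * q (n - k)) - p k * r (n - k))‖ₑ
      ≤ X := by
    refine enorm_tsum_le_tsum_enorm.trans (ENNReal.tsum_le_tsum fun k => ?_)
    rw [hqr, show ((√(n.natAbs : ℝ) : ℝ) : ℂ) * (p k * q (n - k)) -
      p k * (((√((n - k).natAbs : ℝ) : ℝ) : ℂ) * q (n - k)) =
      ((√(n.natAbs : ℝ) - √((n - k).natAbs : ℝ) : ℝ) : ℂ) * p k * q (n - k) by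
        push_cast; ring, enorm_mul, enorm_mul]
    gcongr
    rw [← ofReal_norm, Complex.norm_real, Real.norm_eq_abs]
    exact ENNReal.ofReal_le_ofReal (abs_sqrt_natAbs_sub_le n k)
  have hn : (n.natAbs : ℝ≥0∞) * ‖seqConv p q n‖ₑ ^ 2 =
      ‖((√(n.natAbs : ℝ) : ℝ) : ℂ) * seqConv p q n‖ₑ ^ 2 := by
    rw [enorm_mul, mul_pow]
    congr 1
    rw [← ofReal_norm, Complex.norm_real, Real.norm_of_nonneg (by positivity),
      ← ENNReal.ofReal_pow (by positivity), Real.sq_sqrt (by positivity), ENNReal.ofReal_natCast]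
  have hle : ‖((√(n.natAbs : ℝ) : ℝ) : ℂ) * seqConv p q n‖ₑ ≤ ‖seqConv p r n‖ₑ + X := by
    rw [hsplit]
    exact (enorm_add_le _ _).trans (add_le_add le_rfl hrem)
  rw [hn, ← mul_add]
  calc _ ≤ (‖seqConv p r n‖ₑ + X) ^ 2 := by gcongr
    _ ≤ _ := by
      have := ENNReal.rpow_add_le_mul_rpow_add_rpow ‖seqConv p r n‖ₑ X (p := 2) (by norm_num)
      norm_num at this
      exact this

lemma lintegral_circ_enorm_fourierSum_sq {c : ℤ → ℂ} (hc : Summable fun k => ‖c k‖) (a : ℝ) :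
    ∫⁻ x in circ, ‖fourierSum c x‖ₑ ^ 2 =
      ∫⁻ x in Set.Ioc a (a + 2 * π), ‖fourierSum c x‖ₑ ^ 2 := by
  rw [lintegral_enorm_fourierSum_sq hc, ← lintegral_enorm_fourierSum_sq hc (-π), circ,
    show -π + 2 * π = π by ring]

lemma local_fourierSum_L4_estimate {p q r : ℤ → ℂ} (hp : Summable fun k => ‖p k‖)
    (hq : Summable fun k => ‖q k‖) (hr : Summable fun k => ‖r k‖)
    (hqr : ∀ k, r k = ((√(k.natAbs : ℝ) : ℝ) : ℂ) * q k) {a : ℝ} {J₁ J₂ : Set ℝ}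
    (hJ₁ : MeasurableSet J₁) (hJ₂ : MeasurableSet J₂) (hJ₁a : J₁ ⊆ Set.Ioc a (a + 2 * π))
    (hφ : ∀ x, ‖fourierSum p x‖ₑ ≤ 1) (hφ1 : ∀ x ∈ J₁, fourierSum p x = 1)
    (hφ0 : ∀ x ∈ Set.Ioc a (a + 2 * π) \ J₂, fourierSum p x = 0) :
    ∫⁻ x in J₁, ‖fourierSum q x‖ₑ ^ 4 ≤ 12 * (∫⁻ x in J₂, ‖fourierSum q x‖ₑ ^ 2) *
      (2 * (∫⁻ x in J₂, ‖fourierSum r x‖ₑ ^ 2) +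
        (1 + 2 * (∑' k, ENNReal.ofReal √(k.natAbs : ℝ) * ‖p k‖ₑ) ^ 2) *
          ∫⁻ x in circ, ‖fourierSum q x‖ₑ ^ 2) := by
  set c := seqConv p q with hc
  set Ψ := ∑' k, ENNReal.ofReal √(k.natAbs : ℝ) * ‖p k‖ₑ with hΨ
  set P := ENNReal.ofReal (2 * π) with hP
  have hP1 : 1 ≤ P := by
    rw [hP, ENNReal.one_le_ofReal]; linarith [Real.pi_gt_three]
  have hcs : Summable fun k => ‖c k‖ := summable_seqConv hp hq
  have hloc : ∀ {d : ℤ → ℂ}, Summable (fun k => ‖d k‖) →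
      P * ∑' n, ‖seqConv p d n‖ₑ ^ 2 ≤ ∫⁻ x in J₂, ‖fourierSum d x‖ₑ ^ 2 := by
    intro d hd
    rw [hP, ← lintegral_enorm_fourierSum_sq (summable_seqConv hp hd) a,
      ← lintegral_indicator measurableSet_Ioc, ← lintegral_indicator hJ₂]
    refine lintegral_mono fun x => ?_
    by_cases hx : x ∈ Set.Ioc a (a + 2 * π)
    · rw [Set.indicator_of_mem hx, fourierSum_seqConv hp hd]
      by_cases hx2 : x ∈ J₂
      · rw [Set.indicator_of_mem hx2, enorm_mul, mul_pow]
        calc _ ≤ 1 ^ 2 * ‖fourierSum d x‖ₑ ^ 2 := by gcongr; exact hφ x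
          _ = _ := by simp
      · simp [hφ0 x ⟨hx, hx2⟩]
    · rw [Set.indicator_of_notMem hx]
      exact zero_le
  have hglob : P * ∑' n, ‖c n‖ₑ ^ 2 ≤ ∫⁻ x in circ, ‖fourierSum q x‖ₑ ^ 2 := by
    rw [hP, ← lintegral_enorm_fourierSum_sq hcs a, lintegral_circ_enorm_fourierSum_sq hq a]
    refine lintegral_mono fun x => ?_
    rw [hc, fourierSum_seqConv hp hq, enorm_mul, mul_pow]
    calc _ ≤ 1 ^ 2 * ‖fourierSum q x‖ₑ ^ 2 := by gcongr; exact hφ x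
      _ = _ := by simp
  have h4 : ∫⁻ x in J₁, ‖fourierSum q x‖ₑ ^ 4 ≤ P * ∑' n, ‖seqConv c c n‖ₑ ^ 2 := by
    rw [hP, ← lintegral_enorm_fourierSum_sq (summable_seqConv hcs hcs) a]
    calc _ = ∫⁻ x in J₁, ‖fourierSum (seqConv c c) x‖ₑ ^ 2 := by
          refine setLIntegral_congr_fun hJ₁ fun x hx => ?_
          rw [fourierSum_seqConv hcs hcs, hc, fourierSum_seqConv hp hq, hφ1 x hx, one_mul,
            enorm_mul]
          ring
      _ ≤ _ := lintegral_mono_set hJ₁a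
  have hconv : ∑' n, ‖seqConv c c n‖ₑ ^ 2 ≤ ∑' n, (∑' k, ‖c k‖ₑ * ‖c (n - k)‖ₑ) ^ 2 :=
    ENNReal.tsum_le_tsum fun n => by gcongr; exact enorm_seqConv_le c c n
  have hint := ennreal_tsum_conv_sq_le_interp fun k => ‖c k‖ₑ
  have hB : P * ∑' k : ℤ, (1 + (k.natAbs : ℝ≥0∞)) * ‖c k‖ₑ ^ 2 ≤
      2 * (∫⁻ x in J₂, ‖fourierSum r x‖ₑ ^ 2) +
        (1 + 2 * Ψ ^ 2) * ∫⁻ x in circ, ‖fourierSum q x‖ₑ ^ 2 := by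
    have hD : ∫⁻ x in circ, ‖fourierSum q x‖ₑ ^ 2 = P * ∑' k, ‖q k‖ₑ ^ 2 := by
      rw [lintegral_circ_enorm_fourierSum_sq hq 0, lintegral_enorm_fourierSum_sq hq]
    calc P * ∑' k : ℤ, (1 + (k.natAbs : ℝ≥0∞)) * ‖c k‖ₑ ^ 2
        ≤ P * ∑' n : ℤ, (‖c n‖ₑ ^ 2 + (2 * ‖seqConv p r n‖ₑ ^ 2 +
          2 * (∑' k, ENNReal.ofReal √(k.natAbs : ℝ) * ‖p k‖ₑ * ‖q (n - k)‖ₑ) ^ 2)) := by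
          gcongr with n
          rw [add_mul, one_mul]
          gcongr
          exact natAbs_mul_enorm_seqConv_sq_le hp hq hr hqr n
      _ = P * ∑' n, ‖c n‖ₑ ^ 2 + (2 * (P * ∑' n, ‖seqConv p r n‖ₑ ^ 2) + 2 * (P *
          ∑' n, (∑' k, ENNReal.ofReal √(k.natAbs : ℝ) * ‖p k‖ₑ * ‖q (n - k)‖ₑ) ^ 2)) := by
          rw [ENNReal.tsum_add, ENNReal.tsum_add, ENNReal.tsum_mul_left, ENNReal.tsum_mul_left]
          ring
      _ ≤ (∫⁻ x in circ, ‖fourierSum q x‖ₑ ^ 2) + (2 * (∫⁻ x in J₂, ‖fourierSum r x‖ₑ ^ 2) +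
          2 * (P * (Ψ ^ 2 * ∑' k, ‖q k‖ₑ ^ 2))) := by
          refine add_le_add hglob (add_le_add (mul_le_mul' le_rfl (hloc hr))
            (mul_le_mul' le_rfl (mul_le_mul' le_rfl ?_)))
          exact ennreal_young_one_two (fun k => ENNReal.ofReal √(k.natAbs : ℝ) * ‖p k‖ₑ)
            fun k => ‖q k‖ₑ
      _ = _ := by rw [hD]; ring
  calc ∫⁻ x in J₁, ‖fourierSum q x‖ₑ ^ 4 ≤ P * ∑' n, ‖seqConv c c n‖ₑ ^ 2 := h4
    _ ≤ P * (12 * (∑' k, ‖c k‖ₑ ^ 2) * ∑' k : ℤ, (1 + (k.natAbs : ℝ≥0∞)) * ‖c k‖ₑ ^ 2) :=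
      mul_le_mul' le_rfl (hconv.trans hint)
    _ ≤ P * (12 * (∑' k, ‖c k‖ₑ ^ 2) * (P * ∑' k : ℤ, (1 + (k.natAbs : ℝ≥0∞)) * ‖c k‖ₑ ^ 2)) := by
      gcongr
      exact le_mul_of_one_le_left zero_le hP1
    _ = 12 * (P * ∑' k, ‖c k‖ₑ ^ 2) *
        (P * ∑' k : ℤ, (1 + (k.natAbs : ℝ≥0∞)) * ‖c k‖ₑ ^ 2) := by ring
    _ ≤ _ := by
      refine mul_le_mul' (mul_le_mul' le_rfl (hloc hq)) hB

/-! ### Summability of the coefficients -/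

lemma summable_norm_fc_of_sq_mul_le {f : ℝ → ℂ} {B : ℝ}
    (h : ∀ k : ℤ, (k : ℝ) ^ 2 * ‖fc f k‖ ≤ B) : Summable fun k => ‖fc f k‖ := by
  have hs : Summable fun k : ℤ => B * (1 / (k : ℝ) ^ 2) :=
    (Real.summable_one_div_int_pow.2 one_lt_two).mul_left B
  refine Summable.of_norm_bounded_eventually (g := fun k : ℤ => B * (1 / (k : ℝ) ^ 2)) hs ?_
  filter_upwards [(Set.finite_singleton (0 : ℤ)).compl_mem_cofinite] with k hk
  have hk0 : (0 : ℝ) < (k : ℝ) ^ 2 := by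
    have : (k : ℝ) ≠ 0 := by exact_mod_cast hk
    positivity
  rw [norm_norm, mul_one_div, le_div_iff₀ hk0, mul_comm]
  exact h k

lemma tsum_sqrt_mul_enorm_le {f : ℝ → ℂ} {B : ℝ} (hB : 0 ≤ B)
    (h : ∀ k : ℤ, (k : ℝ) ^ 2 * ‖fc f k‖ ≤ B) :
    ∑' k : ℤ, ENNReal.ofReal √(k.natAbs : ℝ) * ‖fc f k‖ₑ ≤
      ENNReal.ofReal (B * ∑' k : ℤ, |(k : ℝ)| ^ (-(3 / 2 : ℝ))) := by
  have hs : Summable fun k : ℤ => |(k : ℝ)| ^ (-(3 / 2 : ℝ)) :=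
    Real.summable_abs_int_rpow (by norm_num)
  rw [← tsum_mul_left, ENNReal.ofReal_tsum_of_nonneg (fun k => by positivity) (hs.mul_left B)]
  refine ENNReal.tsum_le_tsum fun k => ?_
  rw [← ofReal_norm, ← ENNReal.ofReal_mul (by positivity)]
  refine ENNReal.ofReal_le_ofReal ?_
  rcases eq_or_ne k 0 with rfl | hk
  · simp only [Int.natAbs_zero, Nat.cast_zero, Real.sqrt_zero, zero_mul]
    positivity
  · have hk0 : 0 < |(k : ℝ)| := abs_pos.2 (by exact_mod_cast hk)
    have hpow : |(k : ℝ)| ^ (-(3 / 2 : ℝ)) * (k : ℝ) ^ 2 = √(k.natAbs : ℝ) := by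
      rw [← sq_abs, ← Real.rpow_natCast, ← Real.rpow_add hk0, Nat.cast_natAbs, Int.cast_abs,
        Real.sqrt_eq_rpow]
      norm_num
    rw [← hpow, mul_assoc, mul_comm B]
    gcongr
    exact h k

/-- The Fourier coefficients of `(-Δ)^s f`. -/
def fracCoeff (s : ℝ) (f : ℝ → ℝ) (k : ℤ) : ℂ :=
  (((k.natAbs : ℝ) ^ s : ℝ) : ℂ) * fc (fun y => (f y : ℂ)) k

lemma norm_fracCoeff (s : ℝ) (f : ℝ → ℝ) (k : ℤ) :
    ‖fracCoeff s f k‖ = (k.natAbs : ℝ) ^ s * ‖fc (fun y => (f y : ℂ)) k‖ := by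
  rw [fracCoeff, norm_mul, Complex.norm_real, Real.norm_of_nonneg (by positivity)]

lemma fracCoeff_one (f : ℝ → ℝ) (k : ℤ) :
    fracCoeff 1 f k = ((√(k.natAbs : ℝ) : ℝ) : ℂ) * fracCoeff (1 / 2) f k := by
  rw [fracCoeff, fracCoeff, ← mul_assoc, ← Complex.ofReal_mul, ← Real.sqrt_eq_rpow,
    Real.mul_self_sqrt (by positivity), Real.rpow_one]

lemma fourierSum_fracCoeff (s : ℝ) (f : ℝ → ℝ) (x : ℝ) :
    fourierSum (fracCoeff s f) x = (fracLapR s f x : ℂ) := by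
  have h : (starRingEnd ℂ) (fourierSum (fracCoeff s f) x) = fourierSum (fracCoeff s f) x := by
    rw [conj_fourierSum]
    congr 1
    ext k
    rw [fracCoeff, map_mul, conj_fc_ofReal, Complex.conj_ofReal, Int.natAbs_neg, fracCoeff]
  exact (Complex.conj_eq_iff_re.1 h).symm

lemma Function.Periodic.deriv' {g : ℝ → ℝ} {T : ℝ} (hg : Function.Periodic g T) :
    Function.Periodic (deriv g) T := fun x => by
  rw [← deriv_comp_add_const]
  congr 1
  ext y
  exact hg y

lemma summable_fracCoeff_one {f : ℝ → ℝ} (hf : ContDiff ℝ 3 f)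
    (hp : Function.Periodic f (2 * π)) : Summable fun k => ‖fracCoeff 1 f k‖ := by
  have h1 : ContDiff ℝ 2 (deriv f) :=
    ((contDiff_succ_iff_deriv (n := 2)).1 (by rw [two_add_one_eq_three]; exact hf)).2.2
  have h2 : ContDiff ℝ 1 (deriv (deriv f)) :=
    ((contDiff_succ_iff_deriv (n := 1)).1 (by rw [one_add_one_eq_two]; exact h1)).2.2
  have h3 : Continuous (deriv (deriv (deriv f))) := h2.continuous_deriv le_rfl
  have hd : ∀ {g : ℝ → ℝ}, Differentiable ℝ g →
      ∀ x, HasDerivAt (fun x => (g x : ℂ)) ((deriv g x : ℝ) : ℂ) x :=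
    fun hg x => (hg x).hasDerivAt.ofReal_comp
  have hd0 := hd (hf.differentiable (by norm_num))
  have hc1 : Continuous fun x => ((deriv f x : ℝ) : ℂ) :=
    Complex.continuous_ofReal.comp h1.continuous
  have hb := norm_fc_mul_sq_le (hd (h1.differentiable (by norm_num)))
    (hd (h2.differentiable (by norm_num))) (Complex.continuous_ofReal.comp h3)
    (fun x => by simp only [hp.deriv' x]) (fun x => by simp only [hp.deriv'.deriv' x])
  have hsum := summable_norm_fc_of_sq_mul_le hb
  refine hsum.congr fun k => ?_
  rw [fc_of_hasDerivAt hd0 hc1 (fun x => by simp only [hp x]), norm_fracCoeff, Real.rpow_one]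
  simp [Nat.cast_natAbs]

lemma summable_fracCoeff_half {f : ℝ → ℝ} (hf : Summable fun k => ‖fracCoeff 1 f k‖) :
    Summable fun k => ‖fracCoeff (1 / 2) f k‖ := by
  refine hf.of_nonneg_of_le (fun _ => norm_nonneg _) fun k => ?_
  rw [norm_fracCoeff, norm_fracCoeff]
  refine mul_le_mul_of_nonneg_right ?_ (norm_nonneg _)
  rcases Nat.eq_zero_or_pos k.natAbs with h | h
  · simp [h]
  · exact Real.rpow_le_rpow_of_exponent_le (Nat.one_le_cast.2 h) (by norm_num)

lemma enorm_ofReal_sq (v : ℝ) : ‖(v : ℂ)‖ₑ ^ 2 = ENNReal.ofReal (v ^ 2) := by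
  rw [← ofReal_norm, ← ENNReal.ofReal_pow (norm_nonneg _), Complex.norm_real, Real.norm_eq_abs,
    sq_abs]

lemma enorm_ofReal_pow_four (v : ℝ) : ‖(v : ℂ)‖ₑ ^ 4 = ENNReal.ofReal (v ^ 4) := by
  rw [show v ^ 4 = (v ^ 2) ^ 2 by ring, ENNReal.ofReal_pow (by positivity), ← enorm_ofReal_sq]
  ring

lemma exists_local_L4_estimate : ∃ C : ℝ, 0 < C ∧ ∀ f : ℝ → ℝ, ContDiff ℝ 3 f →
    Function.Periodic f (2 * π) → ∀ R : ℝ, 0 < R → R < 1 → ∀ x₀ : ℝ,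
      ∫⁻ x in Set.Ioo (x₀ - 3 * R / 4) (x₀ + 3 * R / 4),
          ENNReal.ofReal (fracLapR (1 / 2) f x ^ 4) ≤
        ENNReal.ofReal C *
          (∫⁻ x in Set.Ioo (x₀ - R) (x₀ + R), ENNReal.ofReal (fracLapR (1 / 2) f x ^ 2)) *
          ((∫⁻ x in Set.Ioo (x₀ - R) (x₀ + R), ENNReal.ofReal (fracLapR 1 f x ^ 2)) +
            ENNReal.ofReal (1 / R ^ 2) *
              ∫⁻ x in circ, ENNReal.ofReal (fracLapR (1 / 2) f x ^ 2)) := by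
  obtain ⟨K, hK, hcut⟩ := exists_cutoff
  set S : ℝ := ∑' k : ℤ, |(k : ℝ)| ^ (-(3 / 2 : ℝ)) with hS
  have hS0 : 0 ≤ S := tsum_nonneg fun k => by positivity
  refine ⟨12 * (2 + 2 * (K * S) ^ 2), by positivity, fun f hf hfp R hR hR1 x₀ => ?_⟩
  obtain ⟨φ, hφc, hφp, hφ0, hφ1, hone, hzero, hdec⟩ := hcut R hR hR1 x₀
  have hKR : 0 ≤ K / R := by positivity
  have hp := summable_norm_fc_of_sq_mul_le hdec
  have hr := summable_fracCoeff_one hf hfp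
  have hq := summable_fracCoeff_half hr
  have hinv : ∀ x, fourierSum (fc fun x => (φ x : ℂ)) x = φ x := fun x =>
    fourierSum_fc (f := fun x => (φ x : ℂ)) (Complex.continuous_ofReal.comp hφc)
      (fun y => by simp only [hφp y]) hp x
  have hsub : Set.Ioo (x₀ - 3 * R / 4) (x₀ + 3 * R / 4) ⊆
      Set.Ioc (x₀ - π) (x₀ - π + 2 * π) := by
    rintro x ⟨hx1, hx2⟩
    have := Real.pi_gt_three
    exact ⟨by linarith, by linarith⟩
  have hmain := local_fourierSum_L4_estimate hp hq hr (fracCoeff_one f) measurableSet_Ioo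
    (measurableSet_Ioo (a := x₀ - R) (b := x₀ + R)) hsub
    (fun x => by
      rw [hinv, ← ofReal_norm, Complex.norm_real, Real.norm_of_nonneg (hφ0 x),
        ENNReal.ofReal_le_one]
      exact hφ1 x)
    (fun x hx => by rw [hinv, hone x hx, Complex.ofReal_one])
    (fun x hx => by rw [hinv, hzero x hx, Complex.ofReal_zero])
  simp only [fourierSum_fracCoeff, enorm_ofReal_sq, enorm_ofReal_pow_four] at hmain
  refine hmain.trans ?_
  set A := ∫⁻ x in Set.Ioo (x₀ - R) (x₀ + R), ENNReal.ofReal (fracLapR (1 / 2) f x ^ 2)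
  set B := ∫⁻ x in Set.Ioo (x₀ - R) (x₀ + R), ENNReal.ofReal (fracLapR 1 f x ^ 2)
  set D := ∫⁻ x in circ, ENNReal.ofReal (fracLapR (1 / 2) f x ^ 2)
  have hΨ := tsum_sqrt_mul_enorm_le hKR hdec
  have hone_le : (1 : ℝ) ≤ 1 / R ^ 2 := by
    rw [le_div_iff₀ (by positivity)]; nlinarith
  have hcoef : 1 + 2 * (∑' k : ℤ, ENNReal.ofReal √(k.natAbs : ℝ) *
      ‖fc (fun x => (φ x : ℂ)) k‖ₑ) ^ 2 ≤
      ENNReal.ofReal (2 + 2 * (K * S) ^ 2) * ENNReal.ofReal (1 / R ^ 2) := by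
    calc _ ≤ 1 + 2 * (ENNReal.ofReal (K / R * S)) ^ 2 := by gcongr
      _ = ENNReal.ofReal (1 + 2 * (K / R * S) ^ 2) := by
        rw [ENNReal.ofReal_add (by positivity) (by positivity), ENNReal.ofReal_one,
          ENNReal.ofReal_mul (p := 2) (by positivity), ENNReal.ofReal_pow (by positivity),
          show ENNReal.ofReal 2 = 2 by simp]
      _ ≤ _ := by
        rw [← ENNReal.ofReal_mul (by positivity)]
        refine ENNReal.ofReal_le_ofReal ?_
        calc 1 + 2 * (K / R * S) ^ 2 ≤ 2 * (1 / R ^ 2) + 2 * (K / R * S) ^ 2 := by linarith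
          _ = _ := by field_simp
  have htwo : (2 : ℝ≥0∞) ≤ ENNReal.ofReal (2 + 2 * (K * S) ^ 2) := by
    rw [show (2 : ℝ≥0∞) = ENNReal.ofReal 2 by simp]
    exact ENNReal.ofReal_le_ofReal (by nlinarith [sq_nonneg (K * S)])
  calc _ ≤ 12 * A * (ENNReal.ofReal (2 + 2 * (K * S) ^ 2) * B +
        ENNReal.ofReal (2 + 2 * (K * S) ^ 2) * ENNReal.ofReal (1 / R ^ 2) * D) := by gcongr
    _ = _ := by
      rw [ENNReal.ofReal_mul (by norm_num), show ENNReal.ofReal 12 = 12 by simp]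
      ring

/-! ### Measurability in time -/

lemma lintegral_circ_fracLapR_sq {s : ℝ} {f : ℝ → ℝ} (hf : Summable fun k => ‖fracCoeff s f k‖) :
    ∫⁻ x in circ, ENNReal.ofReal (fracLapR s f x ^ 2) =
      ENNReal.ofReal (2 * π) * ∑' k, ‖fracCoeff s f k‖ₑ ^ 2 := by
  simp_rw [← enorm_ofReal_sq, ← fourierSum_fracCoeff]
  rw [lintegral_circ_enorm_fourierSum_sq hf 0, lintegral_enorm_fourierSum_sq hf]

lemma measurable_fc_of_measurable {g : ℝ → ℝ → ℝ} (hg : Measurable fun p : ℝ × ℝ => g p.1 p.2)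
    (k : ℤ) : Measurable fun t => fc (fun y => (g t y : ℂ)) k := by
  have h : StronglyMeasurable (Function.uncurry fun (t x : ℝ) =>
      (g t x : ℂ) * Complex.exp (-(Complex.I * (k : ℂ) * (x : ℂ)))) := by
    refine Measurable.stronglyMeasurable ?_
    change Measurable fun p : ℝ × ℝ =>
      (g p.1 p.2 : ℂ) * Complex.exp (-(Complex.I * (k : ℂ) * (p.2 : ℂ)))
    exact (Complex.measurable_ofReal.comp hg).mul (by fun_prop)
  exact (h.integral_prod_right (ν := volume.restrict circ)).measurable.const_mul _

/-- Struwe-type local `L⁴` interpolation estimate for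
`v = (-Δ)^{1/4}u` and `w = (-Δ)^{1/2}u` on `[0,T] × S¹`. -/
theorem struwe_local_L4_estimate :
    ∃ C : ℝ, 0 < C ∧
      ∀ T : ℝ, 0 < T → ∀ u : ℝ → ℝ → ℝ,
        ContDiffOn ℝ (⊤ : ℕ∞) (fun p : ℝ × ℝ => u p.1 p.2)
          ((Set.Icc 0 T) ×ˢ (Set.univ : Set ℝ)) →
        (∀ t, Function.Periodic (u t) (2 * π)) →
        ∀ R : ℝ, 0 < R → R < 1 → ∀ x₀ : ℝ,
          (∫⁻ t in Set.Ioc (0 : ℝ) T, ∫⁻ x in Set.Ioo (x₀ - 3 * R / 4) (x₀ + 3 * R / 4),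
              ENNReal.ofReal (fracLapR (1 / 2) (u t) x ^ 4))
            ≤ ENNReal.ofReal C *
              (⨆ t ∈ Set.Icc (0 : ℝ) T, ∫⁻ x in Set.Ioo (x₀ - R) (x₀ + R),
                  ENNReal.ofReal (fracLapR (1 / 2) (u t) x ^ 2)) *
              ((∫⁻ t in Set.Ioc (0 : ℝ) T, ∫⁻ x in Set.Ioo (x₀ - R) (x₀ + R),
                  ENNReal.ofReal (fracLapR 1 (u t) x ^ 2))
                + ENNReal.ofReal (1 / R ^ 2) *
                  ∫⁻ t in Set.Ioc (0 : ℝ) T, ∫⁻ x in circ,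
                    ENNReal.ofReal (fracLapR (1 / 2) (u t) x ^ 2)) := by
  obtain ⟨C, hC, hfix⟩ := exists_local_L4_estimate
  refine ⟨C, hC, fun T _ u hu hper R hR hR1 x₀ => ?_⟩
  have husm : ∀ t ∈ Set.Ioc 0 T, ContDiff ℝ 3 (u t) := by
    intro t ht
    rw [← contDiffOn_univ]
    have h3 : ContDiffOn ℝ 3 (fun p : ℝ × ℝ => u p.1 p.2) (Set.Icc 0 T ×ˢ Set.univ) :=
      hu.of_le (WithTop.coe_le_coe.2 (le_top : (3 : ℕ∞) ≤ ⊤))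
    exact h3.comp (g := fun p : ℝ × ℝ => u p.1 p.2) (f := fun x : ℝ => (t, x)) (s := Set.univ)
      (contDiff_prodMk_right t).contDiffOn fun x _ => ⟨⟨ht.1.le, ht.2⟩, Set.mem_univ _⟩
  set A : ℝ → ℝ≥0∞ := fun t => ∫⁻ x in Set.Ioo (x₀ - R) (x₀ + R),
    ENNReal.ofReal (fracLapR (1 / 2) (u t) x ^ 2) with hA
  set B : ℝ → ℝ≥0∞ := fun t => ∫⁻ x in Set.Ioo (x₀ - R) (x₀ + R),
    ENNReal.ofReal (fracLapR 1 (u t) x ^ 2) with hB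
  set D : ℝ → ℝ≥0∞ := fun t => ∫⁻ x in circ,
    ENNReal.ofReal (fracLapR (1 / 2) (u t) x ^ 2) with hD
  have hDm : AEMeasurable D (volume.restrict (Set.Ioc 0 T)) := by
    set g : ℝ → ℝ → ℝ := fun t x => (Set.Icc 0 T ×ˢ (Set.univ : Set ℝ)).indicator
      (fun p : ℝ × ℝ => u p.1 p.2) (t, x) with hg
    have hgm : Measurable fun p : ℝ × ℝ => g p.1 p.2 := by
      have hms : MeasurableSet (Set.Icc 0 T ×ˢ (Set.univ : Set ℝ)) :=
        measurableSet_Icc.prod MeasurableSet.univ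
      have := hu.continuousOn.measurable_piecewise
        (continuousOn_const (c := (0 : ℝ)) (s := (Set.Icc 0 T ×ˢ (Set.univ : Set ℝ))ᶜ)) hms
      convert this using 1
      ext p
      simp only [hg, Set.indicator, Set.piecewise]
    refine ⟨fun t => ENNReal.ofReal (2 * π) * ∑' k, ‖fracCoeff (1 / 2) (g t) k‖ₑ ^ 2, ?_, ?_⟩
    · refine Measurable.const_mul (Measurable.tsum fun k => ?_) _
      exact ((measurable_fc_of_measurable hgm k).const_mul _).enorm.pow_const 2
    · filter_upwards [ae_restrict_mem measurableSet_Ioc] with t ht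
      have hgt : g t = u t := by
        ext x
        exact Set.indicator_of_mem (s := Set.Icc 0 T ×ˢ (Set.univ : Set ℝ))
          (Set.mk_mem_prod ⟨ht.1.le, ht.2⟩ (Set.mem_univ x)) _
      rw [hgt]
      exact lintegral_circ_fracLapR_sq
        (summable_fracCoeff_half (summable_fracCoeff_one (husm t ht) (hper t)))
  have hfixt : ∀ t ∈ Set.Ioc 0 T, ∫⁻ x in Set.Ioo (x₀ - 3 * R / 4) (x₀ + 3 * R / 4),
      ENNReal.ofReal (fracLapR (1 / 2) (u t) x ^ 4) ≤
      ENNReal.ofReal C * A t * (B t + ENNReal.ofReal (1 / R ^ 2) * D t) := fun t ht =>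
    hfix (u t) (husm t ht) (hper t) R hR hR1 x₀
  have hRne : ENNReal.ofReal (1 / R ^ 2) ≠ 0 := by
    rw [Ne, ENNReal.ofReal_eq_zero, not_le]; positivity
  have hCne : ENNReal.ofReal C ≠ 0 := by
    rw [Ne, ENNReal.ofReal_eq_zero, not_le]; exact hC
  have hAD : ∀ t ∈ Set.Ioc 0 T, A t ≤ D t := by
    intro t ht
    have hq := summable_fracCoeff_half (summable_fracCoeff_one (husm t ht) (hper t))
    simp only [hA, hD, ← enorm_ofReal_sq, ← fourierSum_fracCoeff]
    rw [lintegral_circ_enorm_fourierSum_sq hq (x₀ - π)]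
    refine lintegral_mono_set ?_
    rintro x ⟨hx1, hx2⟩
    have := Real.pi_gt_three
    exact ⟨by linarith, by linarith⟩
  set S := ⨆ t ∈ Set.Icc (0 : ℝ) T, A t with hS
  have hsplit : ∫⁻ t in Set.Ioc 0 T, (B t + ENNReal.ofReal (1 / R ^ 2) * D t) =
      (∫⁻ t in Set.Ioc 0 T, B t) + ENNReal.ofReal (1 / R ^ 2) * ∫⁻ t in Set.Ioc 0 T, D t := by
    rw [lintegral_add_right' _ (hDm.const_mul _),
      lintegral_const_mul' _ _ ENNReal.ofReal_ne_top]
  rw [← hsplit]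
  by_cases hD0 : ∫⁻ t in Set.Ioc 0 T, D t = 0
  · have hae := (lintegral_eq_zero_iff' hDm).1 hD0
    refine le_trans (le_of_eq ?_) zero_le
    rw [← lintegral_zero]
    refine lintegral_congr_ae ?_
    filter_upwards [hae, ae_restrict_mem measurableSet_Ioc] with t ht htT
    have hA0 : A t = 0 := le_antisymm ((hAD t htT).trans (le_of_eq ht)) zero_le
    have := hfixt t htT
    rw [hA0, mul_zero, zero_mul] at this
    exact le_antisymm this zero_le
  rcases eq_or_ne S ⊤ with hST | hST
  · have : ∫⁻ t in Set.Ioc 0 T, (B t + ENNReal.ofReal (1 / R ^ 2) * D t) ≠ 0 := by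
      rw [hsplit]
      intro h
      exact mul_ne_zero hRne hD0 (add_eq_zero.1 h).2
    rw [hST, ENNReal.mul_top hCne, ENNReal.top_mul this]
    exact le_top
  calc _ ≤ ∫⁻ t in Set.Ioc 0 T, ENNReal.ofReal C * S *
        (B t + ENNReal.ofReal (1 / R ^ 2) * D t) := by
        refine setLIntegral_mono' measurableSet_Ioc fun t ht => (hfixt t ht).trans ?_
        gcongr
        exact le_iSup₂ (f := fun s (_ : s ∈ Set.Icc 0 T) => A s) t ⟨ht.1.le, ht.2⟩
    _ = _ := lintegral_const_mul' _ _ (ENNReal.mul_ne_top ENNReal.ofReal_ne_top hST)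

end
end
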